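/- arXiv:2110.07286 — 4 statements merged into one kernel-verified Lean document; each statement's English description precedes it below -/
import Mathlib

section
/- Let k ≥ 2 be an integer. Then E(1, k) ≤ 2^{k−2} + 1. -/
/-- The predecessor-endpoint of the `i`-th consecutive pair in a sequence of
length `2 ^ k`. -/
def finLo (k : ℕ) (i : Fin (2 ^ k - 1)) : Fin (2 ^ k) :=
  ⟨i.val, by have h := i.isLt; have h2 : 0 < 2 ^ k := pow_pos (by norm_num) k; omega⟩

/-- The successor-endpoint of the `i`-th consecutive pair in a sequence of
length `2 ^ k`. -/
def finHi (k : ℕ) (i : Fin (2 ^ k - 1)) : Fin (2 ^ k) :=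
  ⟨i.val + 1, by have h := i.isLt; have h2 : 0 < 2 ^ k := pow_pos (by norm_num) k; omega⟩

/-- A `k`-bit Gray code: a sequence of `2 ^ k` vectors in `{0,1}^k` in which every
vector occurs exactly once and consecutive vectors differ in exactly one coordinate. -/
def IsGrayCode (k : ℕ) (g : Fin (2 ^ k) → Fin k → Bool) : Prop :=
  Function.Bijective g ∧
    ∀ i : Fin (2 ^ k - 1), ∃! t : Fin k, g (finLo k i) t ≠ g (finHi k i) t

/-- `D` is the delta sequence of `g`: for each `i`, `D i` is the unique coordinate in
which the `i`-th and `(i+1)`-st vector differ. -/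
def IsDeltaOf (k : ℕ) (g : Fin (2 ^ k) → Fin k → Bool)
    (D : Fin (2 ^ k - 1) → Fin k) : Prop :=
  ∀ (i : Fin (2 ^ k - 1)) (t : Fin k), (g (finLo k i) t ≠ g (finHi k i) t) ↔ t = D i

/-- A `k`-bit delta sequence: the delta sequence of some `k`-bit Gray code. -/
def IsDeltaSequence (k : ℕ) (D : Fin (2 ^ k - 1) → Fin k) : Prop :=
  ∃ g, IsGrayCode k g ∧ IsDeltaOf k g D

/-- Transition counts of a sequence over `Fin k`: the number of occurrences of each symbol. -/
def transCount {m k : ℕ} (D : Fin m → Fin k) (t : Fin k) : ℕ :=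
  (Finset.univ.filter fun i => D i = t).card

/-- Transition counts of a Gray code: the number of consecutive pairs differing in
coordinate `t`. -/
def grayTransCount (k : ℕ) (g : Fin (2 ^ k) → Fin k → Bool) (t : Fin k) : ℕ :=
  (Finset.univ.filter fun i : Fin (2 ^ k - 1) => g (finLo k i) t ≠ g (finHi k i) t).card

/-- The standard (reflected binary) `k`-bit Gray code, whose `i`-th vector is the
binary expansion of `i XOR (i / 2)`; coordinate `0` (row 1) changes most often.
This agrees with the inductive definition: the front facet (last coordinate `0`) is
traversed by the standard `(k-1)`-bit Gray code, then the back facet in reverse order. -/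
def standardGray (k : ℕ) : Fin (2 ^ k) → Fin k → Bool :=
  fun i t => Nat.testBit (i.val ^^^ (i.val / 2)) t.val

/-- A `(c 0, …, c (k-1))`-equiparting matrix: a `j`-tuple of `k`-bit Gray codes where
the last column of each Gray code equals the first column of the next, and the sum of
the transition counts equals `c`. -/
def IsEquipartingMatrix (j k : ℕ) (c : Fin k → ℕ)
    (G : Fin j → Fin (2 ^ k) → Fin k → Bool) : Prop :=
  (∀ i, IsGrayCode k (G i)) ∧
    (∀ i : Fin j, ∀ h : i.val + 1 < j,
      G i ⟨2 ^ k - 1, by have h2 : 0 < 2 ^ k := pow_pos (by norm_num) k; omega⟩ =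
        G ⟨i.val + 1, h⟩ ⟨0, pow_pos (by norm_num) k⟩) ∧
    ∀ t, (∑ i, grayTransCount k (G i) t) = c t

/-- Two equiparting matrices are isomorphic if they lie in one orbit of `(ℤ/2)^k`,
acting by simultaneously flipping all bits in selected rows. -/
def EMIso (j k : ℕ) (G G' : Fin j → Fin (2 ^ k) → Fin k → Bool) : Prop :=
  ∃ β : Fin k → Bool, ∀ i m t, G' i m t = xor (β t) (G i m t)

/-- Two equiparting matrices are equivalent if they lie in one orbit of
`(ℤ/2)^k ⋊ Stab`, where `Stab` is the stabilizer of `c` in `S_k`, acting by flipping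
bits in selected rows and permuting rows. -/
def EMEquiv (j k : ℕ) (c : Fin k → ℕ)
    (G G' : Fin j → Fin (2 ^ k) → Fin k → Bool) : Prop :=
  ∃ (β : Fin k → Bool) (τ : Equiv.Perm (Fin k)),
    (∀ t, c (τ t) = c t) ∧ ∀ i m t, G' i m t = xor (β t) (G i m (τ t))

/-- The number of isomorphism classes of `c`-equiparting matrices. -/
noncomputable def numIsoClasses (j k : ℕ) (c : Fin k → ℕ) : ℕ :=
  Nat.card (Quot fun G G' : {G // IsEquipartingMatrix j k c G} => EMIso j k G.1 G'.1)

/-- The number of equivalence classes of `c`-equiparting matrices. -/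
noncomputable def numEquivClasses (j k : ℕ) (c : Fin k → ℕ) : ℕ :=
  Nat.card (Quot fun G G' : {G // IsEquipartingMatrix j k c G} => EMEquiv j k c G.1 G'.1)


set_option linter.unusedSectionVars false
set_option linter.unusedSimpArgs false
section A
variable {α : Type*} [DecidableEq α]

def Good (D : List α) : Prop :=
  ∀ v, v <:+: D → (∀ t, (v.count t).bodd = false) → v = []

theorem Good.mono {D E : List α} (h : Good D) (hE : E <:+: D) : Good E :=
  fun v hv => h v (hv.trans hE)

theorem Good.reverse {D : List α} (h : Good D) : Good D.reverse := by
  intro v hv he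
  have := h v.reverse (by simpa using List.reverse_infix.2 hv) (by simpa using he)
  simpa using this

theorem count_map_perm (σ : Equiv.Perm α) (D : List α) (t : α) :
    (D.map σ).count t = D.count (σ.symm t) := by
  have := List.count_map_of_injective D σ σ.injective (σ.symm t)
  simpa using this

theorem Good.map {D : List α} (h : Good D) (σ : Equiv.Perm α) : Good (D.map σ) := by
  intro v hv he
  have h1 : v.map σ.symm <:+: D := by
    have := List.IsInfix.map σ.symm hv
    simpa using this
  have := h _ h1 (by intro t; rw [count_map_perm]; exact he _)
  simpa using this

theorem good_mid {u v : List α} {x : α} (hu : Good u) (hv : Good v) (hxu : x ∉ u) (hxv : x ∉ v) :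
    Good (u ++ x :: v) := by
  intro w hw he
  have hc : w.count x ≤ 1 := by
    have := hw.sublist.count_le x
    simpa [List.count_eq_zero_of_not_mem hxu, List.count_eq_zero_of_not_mem hxv] using this
  have hx : x ∉ w := by
    intro hx
    have h1 : 0 < w.count x := List.count_pos_iff.2 hx
    have h2 : w.count x = 1 := by omega
    have := he x
    rw [h2] at this; simp at this
  rcases List.infix_append_iff.1 hw with h | h | ⟨l1, l2, h1, h2, h3⟩
  · exact hu w h he
  · rcases List.infix_cons_iff.1 h with h | h
    · cases w with
      | nil => rfl
      | cons y w =>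
        have := (List.cons_prefix_cons.1 h).1
        subst this; simp at hx
    · exact hv w h he
  · cases l2 with
    | nil =>
      refine hu w ?_ he
      rw [h1]; simpa using h2.isInfix
    | cons y l =>
      have := (List.cons_prefix_cons.1 h3).1
      subst this; simp [h1] at hx

/-- split -/
theorem twisted_pal (σ : Equiv.Perm α) {D : List α} {m : ℕ} (hl : D.length = 2 * m + 1)
    (h : (D.map σ).reverse = D) :
    ∃ w x, w.length = m ∧ D = w ++ x :: (w.map σ).reverse ∧ σ x = x := by
  have hm : m < D.length := by omega
  have hD : D = D.take m ++ D[m] :: D.drop (m + 1) := by simp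
  set w := D.take m with hw
  set x := D[m] with hx
  set r := D.drop (m+1) with hr
  have hwl : w.length = m := by simp [hw]; omega
  have hrl : r.length = m := by simp [hr]; omega
  clear_value w x r
  subst hD
  simp only [List.map_append, List.map_cons, List.reverse_append, List.reverse_cons,
    List.append_assoc, List.singleton_append] at h
  have := List.append_inj h (by simp [hwl, hrl])
  obtain ⟨h1, h2⟩ := this
  simp at h2
  exact ⟨w, x, hwl, by rw [h2.2], h2.1⟩

theorem pal {D : List α} {m : ℕ} (hl : D.length = 2 * m + 1)
    (h : D.reverse = D) :
    ∃ w x, w.length = m ∧ D = w ++ x :: w.reverse := by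
  obtain ⟨w, x, h1, h2, -⟩ := twisted_pal (Equiv.refl α) hl (by simpa using h)
  exact ⟨w, x, h1, by simpa using h2⟩

theorem mod4 {s : Finset α} (a b : α → α) (ha : ∀ x ∈ s, a x ∈ s) (hb : ∀ x ∈ s, b x ∈ s)
    (haa : ∀ x, a (a x) = x) (hbb : ∀ x, b (b x) = x) (hab : ∀ x, a (b x) = b (a x))
    (h1 : ∀ x ∈ s, a x ≠ x) (h2 : ∀ x ∈ s, a (b x) ≠ x) (h3 : ∀ x ∈ s, b x ≠ x) :
    s.card % 4 = 0 := by
  induction s using Finset.strongInduction with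
  | H s ih =>
    rcases s.eq_empty_or_nonempty with rfl | ⟨x, hx⟩
    · simp
    have hsub : ({x, a x, b x, a (b x)} : Finset α) ⊆ s := by
      intro y; simp; rintro (rfl | rfl | rfl | rfl)
      exacts [hx, ha _ hx, hb _ hx, ha _ (hb _ hx)]
    have hc : ({x, a x, b x, a (b x)} : Finset α).card = 4 := by
      have e1 := h1 x hx
      have e2 := h2 x hx
      have e3 := h3 x hx
      have e4 : a x ≠ b x := fun h => h2 x hx (by rw [← h, haa])
      have e5 : a x ≠ a (b x) := fun h => h3 x hx (by have := congrArg a h; rw [haa, haa] at this; exact this.symm)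
      have e6 := h1 _ (hb x hx)
      rw [Finset.card_insert_of_notMem, Finset.card_insert_of_notMem, Finset.card_pair e6.symm]
      · simp; tauto
      · simp; exact ⟨e1.symm, e3.symm, e2.symm⟩
    have hi := ih (s \ {x, a x, b x, a (b x)}) (by
      refine Finset.sdiff_ssubset hsub ⟨x, by simp⟩) ?_ ?_ ?_ ?_ ?_
    · rw [Finset.card_sdiff_of_subset hsub, hc] at hi
      have := Finset.card_le_card hsub
      omega
    · intro y; simp only [Finset.mem_sdiff, Finset.mem_insert, Finset.mem_singleton]
      rintro ⟨hy, hn⟩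
      refine ⟨ha y hy, fun h => hn ?_⟩
      rcases h with h | h | h | h
      all_goals (have h' := congrArg a h; simp only [haa] at h'; simp [h'])
    · intro y; simp only [Finset.mem_sdiff, Finset.mem_insert, Finset.mem_singleton]
      rintro ⟨hy, hn⟩
      refine ⟨hb y hy, fun h => hn ?_⟩
      rcases h with h | h | h | h
      all_goals (have h' := congrArg b h; simp only [hbb, ← hab] at h'; simp [h'])
    · intro y hy; exact h1 y (Finset.mem_sdiff.1 hy).1
    · intro y hy; exact h2 y (Finset.mem_sdiff.1 hy).1
    · intro y hy; exact h3 y (Finset.mem_sdiff.1 hy).1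

theorem mod4' {s : Set α} (hs : s.Finite) (a b : α → α) (ha : ∀ x ∈ s, a x ∈ s) (hb : ∀ x ∈ s, b x ∈ s)
    (haa : ∀ x, a (a x) = x) (hbb : ∀ x, b (b x) = x) (hab : ∀ x, a (b x) = b (a x))
    (h1 : ∀ x ∈ s, a x ≠ x) (h2 : ∀ x ∈ s, a (b x) ≠ x) :
    s.ncard % 4 = {x ∈ s | b x = x}.ncard % 4 := by
  classical
  lift s to Finset α using hs
  have e : {x ∈ (s : Set α) | b x = x} = ((s.filter (fun x => b x = x) : Finset α) : Set α) := by
    ext; simp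
  rw [e, Set.ncard_coe_finset, Set.ncard_coe_finset,
    ← Finset.card_filter_add_card_filter_not (s := s) (fun x => b x = x)]
  have := mod4 (s := s.filter (fun x => ¬ b x = x)) a b ?_ ?_ haa hbb hab ?_ ?_ ?_
  · omega
  · intro x; simp only [Finset.mem_filter]; rintro ⟨hx, hn⟩
    refine ⟨ha x hx, fun h => hn ?_⟩
    rw [← hab] at h
    have := congrArg a h
    simpa [haa] using this
  · intro x; simp only [Finset.mem_filter]; rintro ⟨hx, hn⟩
    refine ⟨hb x hx, fun h => hn ?_⟩
    have := congrArg b h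
    simpa [hbb] using this
  · intro x hx; exact h1 x (Finset.mem_filter.1 hx).1
  · intro x hx; exact h2 x (Finset.mem_filter.1 hx).1
  · intro x hx; exact (Finset.mem_filter.1 hx).2

/-- The three families of words. -/
def SS (a b x : α) (h : α → ℕ) (L M : ℕ) : Set (List α) :=
  {D | D.length = 4 * L + 3 ∧ Good D ∧ D.count a = 2 * M + 1 ∧ D.count b = 2 * M + 1 ∧
    D.count x = 1 ∧ ∀ i, i ≠ a → i ≠ b → i ≠ x → D.count i = 4 * h i}

def TT (a b x : α) (h : α → ℕ) (L M : ℕ) : Set (List α) :=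
  {D | D.length = 2 * L + 1 ∧ Good D ∧ D.count a + D.count b = 2 * M + 1 ∧
    D.count x = 0 ∧ ∀ i, i ≠ a → i ≠ b → i ≠ x → D.count i = 2 * h i}

def UU (a b x : α) (h : α → ℕ) (L M : ℕ) : Set (List α) :=
  {D | D.length = L ∧ Good D ∧ D.count a = M ∧ D.count b = 0 ∧
    D.count x = 0 ∧ ∀ i, i ≠ a → i ≠ b → i ≠ x → D.count i = h i}

theorem map_swap_ne {a b : α} (hab : a ≠ b) {D : List α} (ha : a ∈ D ∨ b ∈ D) :
    D.map (Equiv.swap a b) ≠ D := by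
  intro h
  have h : ∀ y ∈ D, Equiv.swap a b y = y := by
    have h' : D.map (Equiv.swap a b) = D.map id := by simpa using h
    exact List.map_inj_left.1 h'
  rcases ha with ha | ha
  · have := h a ha; simp at this; exact hab this.symm
  · have := h b ha; simp at this; exact hab this

theorem finite_len [Finite α] (n : ℕ) {s : Set (List α)} (h : ∀ D ∈ s, D.length = n) : s.Finite :=
  (List.finite_length_eq α n).subset h

theorem map_swap_map (a b : α) (D : List α) :
    (D.map (Equiv.swap a b)).map (Equiv.swap a b) = D := by
  rw [List.map_map]; convert List.map_id D; ext; simp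

theorem SS_map {a b x : α} (hxa : x ≠ a) (hxb : x ≠ b) {h : α → ℕ} {L M : ℕ} :
    ∀ D ∈ SS a b x h L M, D.map (Equiv.swap a b) ∈ SS a b x h L M := by
  rintro D ⟨h1, h2, h3, h4, h5, h6⟩
  refine ⟨by simpa, h2.map _, ?_, ?_, ?_, ?_⟩
  · rw [count_map_perm]; simpa
  · rw [count_map_perm]; simpa
  · rw [count_map_perm, Equiv.symm_swap, Equiv.swap_apply_of_ne_of_ne hxa hxb, h5]
  · intro i ha hb hx
    rw [count_map_perm, Equiv.symm_swap, Equiv.swap_apply_of_ne_of_ne ha hb, h6 i ha hb hx]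

theorem TT_map {a b x : α} (hxa : x ≠ a) (hxb : x ≠ b) {h : α → ℕ} {L M : ℕ} :
    ∀ D ∈ TT a b x h L M, D.map (Equiv.swap a b) ∈ TT a b x h L M := by
  rintro D ⟨h1, h2, h3, h5, h6⟩
  refine ⟨by simpa, h2.map _, ?_, ?_, ?_⟩
  · rw [count_map_perm, count_map_perm]; simp; omega
  · rw [count_map_perm, Equiv.symm_swap, Equiv.swap_apply_of_ne_of_ne hxa hxb, h5]
  · intro i ha hb hx
    rw [count_map_perm, Equiv.symm_swap, Equiv.swap_apply_of_ne_of_ne ha hb, h6 i ha hb hx]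

theorem TT_rev {a b x : α} {h : α → ℕ} {L M : ℕ} :
    ∀ D ∈ TT a b x h L M, D.reverse ∈ TT a b x h L M := by
  rintro D ⟨h1, h2, h3, h5, h6⟩
  exact ⟨by simpa, h2.reverse, by simpa, by simpa, by simpa⟩

theorem SS_rev {a b x : α} {h : α → ℕ} {L M : ℕ} :
    ∀ D ∈ SS a b x h L M, D.reverse ∈ SS a b x h L M := by
  rintro D ⟨h1, h2, h3, h4, h5, h6⟩
  exact ⟨by simpa, h2.reverse, by simpa, by simpa, by simpa, by simpa⟩

theorem SS_mod [Finite α] {a b x : α} (hab : a ≠ b) (hxa : x ≠ a) (hxb : x ≠ b) {h : α → ℕ}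
    {L M : ℕ} : (SS a b x h L M).ncard % 4 = (TT a b x h L M).ncard % 4 := by
  have key := mod4' (s := SS a b x h L M) (finite_len (4 * L + 3) (fun D hD => hD.1))
    (fun D => D.map (Equiv.swap a b)) (fun D => (D.map (Equiv.swap a b)).reverse)
    (SS_map hxa hxb) (fun D hD => SS_rev _ (SS_map hxa hxb D hD))
    (map_swap_map a b) (by intro D; simp only [List.map_reverse, List.reverse_reverse]; exact map_swap_map a b D)
    (by intro D; simp only [List.map_reverse])
    (fun D hD => map_swap_ne hab (Or.inl (List.count_pos_iff.1 (by rw [hD.2.2.1]; omega))))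
    ?_
  · rw [key]; congr 1; symm
    refine Set.ncard_congr (fun w _ => w ++ x :: (w.map (Equiv.swap a b)).reverse) ?_ ?_ ?_
    · rintro w ⟨h1, h2, h3, h5, h6⟩
      have hx : x ∉ w := List.count_eq_zero.1 h5
      have hx' : x ∉ (w.map (Equiv.swap a b)).reverse := by
        rw [← List.count_eq_zero, List.count_reverse, count_map_perm, Equiv.symm_swap,
          Equiv.swap_apply_of_ne_of_ne hxa hxb, h5]
      refine ⟨⟨by simp; omega, good_mid h2 (h2.map _).reverse hx hx', ?_, ?_, ?_, ?_⟩, ?_⟩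
      · simp [List.count_append, List.count_cons, count_map_perm, hxa]; omega
      · simp [List.count_append, List.count_cons, count_map_perm, hxb]; omega
      · rw [List.count_append, List.count_cons_self, List.count_eq_zero_of_not_mem hx,
          List.count_eq_zero_of_not_mem hx']
      · intro i ha hb hx
        simp [List.count_append, List.count_cons, count_map_perm, hx.symm,
          Equiv.swap_apply_of_ne_of_ne ha hb, h6 i ha hb hx]; omega
      · simp only [List.map_append, List.map_cons, List.map_reverse, List.reverse_append,
          List.reverse_cons, List.reverse_reverse, map_swap_map,
          Equiv.swap_apply_of_ne_of_ne hxa hxb, List.append_assoc, List.singleton_append]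
    · intro u v hu hv huv
      exact (List.append_inj huv (by rw [hu.1, hv.1])).1
    · rintro D ⟨⟨h1, h2, h3, h4, h5, h6⟩, hD⟩
      obtain ⟨w, y, hw, rfl, hy⟩ := twisted_pal (m := 2 * L + 1) (Equiv.swap a b) (by omega) hD
      have hya : y ≠ a := by rintro rfl; simp at hy; exact hab hy.symm
      have hyb : y ≠ b := by rintro rfl; simp at hy; exact hab hy
      have hyx : y = x := by
        by_contra hyx
        have := h6 y hya hyb hyx
        simp [List.count_append, List.count_cons, count_map_perm,
          Equiv.swap_apply_of_ne_of_ne hya hyb] at this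
        omega
      subst hyx
      refine ⟨w, ⟨hw, h2.mono List.infix_append_left, ?_, ?_, ?_⟩, rfl⟩
      · simp [List.count_append, List.count_cons, count_map_perm, hya] at h3; omega
      · simp only [List.count_append, List.count_cons_self] at h5; omega
      · intro i ha hb hx
        have := h6 i ha hb hx
        simp [List.count_append, List.count_cons, count_map_perm, hx.symm,
          Equiv.swap_apply_of_ne_of_ne ha hb] at this
        omega
  · intro D hD
    simp only [List.map_reverse, map_swap_map]
    intro hr
    obtain ⟨w, y, hw, rfl⟩ := pal (m := 2 * L + 1) (by rw [hD.1]; omega) hr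
    obtain ⟨h1, h2, h3, h4, h5, h6⟩ := hD
    have e1 : y = a := by
      by_contra hn
      simp [List.count_append, List.count_cons, hn] at h3; omega
    have e2 : y = b := by
      by_contra hn
      simp [List.count_append, List.count_cons, hn] at h4; omega
    exact hab (e1.symm.trans e2)

theorem pal_notMem {u : List α} {y : α} (h : Good (u ++ y :: u.reverse)) : y ∉ u := by
  intro hy
  obtain ⟨p, q, rfl⟩ := List.append_of_mem hy
  have := h (y :: q ++ y :: q.reverse) ⟨p, y :: p.reverse, by simp⟩ ?_
  · simp at this
  · intro t
    have : List.count t (y :: q ++ y :: q.reverse) = 2 * List.count t (y :: q) := by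
      simp [List.count_append, List.count_cons]; omega
    rw [this]; simp

theorem TT_mod [Finite α] {a b x : α} (hab : a ≠ b) (hxa : x ≠ a) (hxb : x ≠ b) {h : α → ℕ}
    {L M : ℕ} (hU : ∃! u, u ∈ UU a b x h L M) : (TT a b x h L M).ncard % 4 = 2 := by
  have mem_or : ∀ D ∈ TT a b x h L M, a ∈ D ∨ b ∈ D := by
    intro D hD
    by_contra hn; push Not at hn
    have := hD.2.2.1
    rw [List.count_eq_zero_of_not_mem hn.1, List.count_eq_zero_of_not_mem hn.2] at this
    omega
  have key := mod4' (s := TT a b x h L M) (finite_len (2 * L + 1) (fun D hD => hD.1))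
    (fun D => D.map (Equiv.swap a b)) List.reverse
    (TT_map hxa hxb) TT_rev
    (map_swap_map a b) List.reverse_reverse
    (by intro D; simp only [List.map_reverse])
    (fun D hD => map_swap_ne hab (mem_or D hD))
    ?_
  · rw [key]
    obtain ⟨u, hu, huu⟩ := hU
    have hp : u ++ b :: u.reverse ∈ TT a b x h L M := by
      obtain ⟨h1, h2, h3, h4, h5, h6⟩ := hu
      have hb : b ∉ u := List.count_eq_zero.1 h4
      refine ⟨by simp; omega, good_mid h2 h2.reverse hb (by simpa), ?_, ?_, ?_⟩
      · simp [List.count_append, List.count_cons, hab.symm, h4, h3]; omega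
      · simp [List.count_append, List.count_cons, hxb.symm, h5]
      · intro i ia ib ix
        simp [List.count_append, List.count_cons, ib.symm, h6 i ia ib ix]; omega
    have claim : ∀ w ∈ TT a b x h L M, ∀ v, w = v ++ b :: v.reverse → w = u ++ b :: u.reverse := by
      rintro w ⟨h1, h2, h3, h5, h6⟩ v rfl
      have hb : b ∉ v := pal_notMem h2
      have hb0 := List.count_eq_zero_of_not_mem hb
      have : v ∈ UU a b x h L M := by
        refine ⟨by simp at h1; omega, h2.mono List.infix_append_left, ?_, hb0, ?_, ?_⟩
        · simp [List.count_append, List.count_cons, hab.symm, hb0] at h3; omega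
        · rw [List.count_append] at h5; omega
        · intro i ia ib ix
          have := h6 i ia ib ix
          simp [List.count_append, List.count_cons, ib.symm] at this; omega
      rw [huu v this]
    have e : {w ∈ TT a b x h L M | w.reverse = w} =
        {u ++ b :: u.reverse, (u ++ b :: u.reverse).map (Equiv.swap a b)} := by
      ext w
      simp only [Set.mem_ofPred_eq, Set.mem_insert_iff, Set.mem_singleton_iff]
      constructor
      · rintro ⟨hw, hr⟩
        obtain ⟨v, y, hv, e⟩ := pal hw.1 hr
        by_cases hy : y = b
        · subst hy; left; exact claim w hw v e
        · right
          have hya : y = a := by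
            by_contra hya
            obtain ⟨h1, h2, h3, h5, h6⟩ := hw
            subst e
            simp [List.count_append, List.count_cons, hya, hy] at h3; omega
          subst hya
          have := claim _ (TT_map hxa hxb w hw) (v.map (Equiv.swap y b)) (by simp [e])
          rw [← this, map_swap_map]
      · rintro (rfl | rfl)
        · exact ⟨hp, by simp⟩
        · exact ⟨TT_map hxa hxb _ hp, by simp⟩
    rw [e, Set.ncard_pair (map_swap_ne hab (Or.inr (by simp))).symm]
  · intro D hD hr
    have := congrArg (List.count a) hr
    rw [count_map_perm] at this
    simp at this
    have := hD.2.2.1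
    omega

end A

section B
variable {α : Type*} [DecidableEq α]

/-- interleave -/
def il (z : α) (u : List α) : List α := z :: u.flatMap (fun x => [x, z])

theorem il_cons (z x : α) (u : List α) : il z (x :: u) = z :: x :: il z u := by
  simp [il]

theorem alt (z : α) : ∀ u : List α, ¬ [z, z] <:+: u → 2 * u.count z ≤ u.length + 1 ∧
    (2 * u.count z = u.length + 1 → u = il z (u.filter (fun y => y ≠ z)))
  | [], _ => by simp
  | [x], _ => by
    by_cases h : x = z
    · subst h; simp [il]
    · simp [h]
  | x :: y :: t, h => by
    have hyt := alt z (y :: t) (fun h' => h (List.infix_cons h'))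
    have ht := alt z t (fun h' => h (List.infix_cons (List.infix_cons h')))
    by_cases hx : x = z
    · subst hx
      have hy : y ≠ x := by
        rintro rfl
        exact h ⟨[], t, by simp⟩
      have : (x :: y :: t).count x = t.count x + 1 := by simp [List.count_cons, hy]
      rw [this]
      refine ⟨by simp only [List.length_cons]; omega, fun h2 => ?_⟩
      have h3 := ht.2 (by simp only [List.length_cons] at h2; omega)
      have : (x :: y :: t).filter (fun y => y ≠ x) = y :: t.filter (fun y => y ≠ x) := by
        simp [hy]
      rw [this, il_cons, ← h3]
    · have : (x :: y :: t).count z = (y :: t).count z := by rw [List.count_cons]; simp [hx]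
      rw [this]
      have h4 := hyt.1
      simp only [List.length_cons] at h4 ⊢
      refine ⟨by omega, fun h2 => by omega⟩

theorem count_fl_z (z : α) (v : List α) (hv : z ∉ v) :
    (v.flatMap (fun x => [x, z])).count z = v.length := by
  induction v with
  | nil => simp
  | cons y v ih =>
    simp at hv
    simp [List.count_cons, ih hv.2, Ne.symm hv.1]

theorem count_fl (z t : α) (v : List α) (ht : t ≠ z) :
    (v.flatMap (fun x => [x, z])).count t = v.count t := by
  induction v with
  | nil => simp
  | cons y v ih =>
    simp [List.count_cons, ih, ht.symm]

theorem even_length (v : List α) (h : ∀ t, (v.count t).bodd = false) : v.length.bodd = false := by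
  have : v.length = ∑ t ∈ v.toFinset, v.count t := by
    rw [List.sum_toFinset_count_eq_length]
  have hb : ∀ n : ℕ, n.bodd = false ↔ n % 2 = 0 := by
    intro n; rw [Nat.mod_two_of_bodd]; cases n.bodd <;> simp
  rw [this, hb, Finset.sum_nat_mod, Finset.sum_eq_zero (fun t _ => (hb _).1 (h t)), Nat.zero_mod]

theorem good_of_il {z : α} {u : List α} (hz : z ∉ u) (h : Good (il z u)) : Good u := by
  rintro v ⟨p, s, rfl⟩ he
  have hzv : z ∉ v := by simp at hz; tauto
  have := h (v.flatMap (fun x => [x, z]))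
    ⟨z :: p.flatMap (fun x => [x, z]), s.flatMap (fun x => [x, z]), by simp [il]⟩ ?_
  · cases v with
    | nil => rfl
    | cons y v => simp at this
  · intro t
    by_cases ht : t = z
    · subst ht; rw [count_fl_z _ _ hzv]; exact even_length v he
    · rw [count_fl _ _ _ ht]; exact he t

theorem filter_il {z : α} {u : List α} (hz : z ∉ u) : (il z u).filter (fun y => y ≠ z) = u := by
  induction u with
  | nil => simp [il]
  | cons y v ih =>
    simp at hz
    rw [il_cons]
    have := ih hz.2
    simp [Ne.symm hz.1]
    simpa using this

theorem il_no {z : α} {u : List α} (hz : z ∉ u) : ¬ [z, z] <:+: il z u := by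
  induction u with
  | nil => 
    intro h; have := h.length_le; simp [il] at this
  | cons y v ih =>
    simp at hz
    rw [il_cons, List.infix_cons_iff, List.infix_cons_iff]
    rintro (h | h | h)
    · simp [List.cons_prefix_cons] at h; exact hz.1 h
    · simp [List.cons_prefix_cons] at h; exact hz.1 h.1
    · exact ih hz.2 h

theorem good_il {z : α} {u : List α} (hz : z ∉ u) (h : Good u) : Good (il z u) := by
  intro v hv he
  have h1 : v.filter (fun y => y ≠ z) <:+: u := by
    have := hv.filter (fun y => decide (y ≠ z))
    rwa [filter_il hz] at this
  have h2 := h _ h1 (by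
    intro t
    by_cases ht : t = z
    · rw [List.count_eq_zero_of_not_mem (by simp [ht])]; rfl
    · rw [List.count_filter (by simp [ht])]; exact he t)
  have h3 : ∀ y ∈ v, y = z := by
    simpa using h2
  match v, h3, hv, he with
  | [], _, _, _ => rfl
  | [x], h3, _, he => have := he x; simp at this
  | x :: y :: t, h3, hv, _ =>
    exfalso
    have e1 : x = z := h3 x (by simp)
    have e2 : y = z := h3 y (by simp)
    subst e1; subst e2
    exact il_no hz (List.IsInfix.trans ⟨[], t, by simp⟩ hv)

theorem uniq (k n : ℕ) (hn : n < k) : ∃! u : List (Fin k), u.length = 2 ^ n - 1 ∧ Good u ∧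
    ∀ i : Fin k, u.count i = if 1 ≤ i.val ∧ i.val ≤ n then 2 ^ (i.val - 1) else 0 := by
  induction n with
  | zero =>
    refine ⟨[], ⟨by simp, ?_, ?_⟩, ?_⟩
    · intro v hv _; simpa using hv
    · intro i; rw [if_neg (by omega)]; simp
    · rintro u ⟨h, -⟩; simpa using h
  | succ n ih =>
    obtain ⟨w, ⟨h1, h2, h3⟩, h4⟩ := ih (by omega)
    set z : Fin k := ⟨n + 1, hn⟩ with hz
    have hp : 2 ^ (n + 1) = 2 * 2 ^ n := by ring
    have hp0 : 0 < 2 ^ n := by positivity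
    have hzw : z ∉ w := by
      rw [← List.count_eq_zero, h3 z, if_neg (by simp [hz])]
    refine ⟨il z w, ⟨?_, good_il hzw h2, ?_⟩, ?_⟩
    · simp [il, List.length_flatMap, h1]; omega
    · intro i
      by_cases hi : i = z
      · rw [hi, il, List.count_cons_self, count_fl_z _ _ hzw, h1, if_pos (by simp [hz])]
        simp [hz]; omega
      · have : i.val ≠ n + 1 := fun h => hi (Fin.ext h)
        rw [il, List.count_cons_of_ne (Ne.symm hi), count_fl _ _ _ hi, h3]
        congr 1
        simp; omega
    · rintro u ⟨g1, g2, g3⟩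
      have hno : ¬ [z, z] <:+: u := by
        intro h
        have := g2 _ h (by intro t; by_cases ht : z = t <;> simp [List.count_cons, ht])
        simp at this
      have gz := g3 z
      rw [if_pos (by simp [hz])] at gz
      have gz' : u.count z = 2 ^ n := by simpa [hz] using gz
      have e := (alt z u hno).2 (by rw [gz', g1]; omega)
      have hzf : z ∉ u.filter (fun y => y ≠ z) := by simp
      have : u.filter (fun y => y ≠ z) = w := by
        apply h4
        refine ⟨?_, good_of_il hzf (e ▸ g2), ?_⟩
        · have := congrArg List.length e
          rw [g1] at this
          simp [il, List.length_flatMap] at this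
          simp; omega
        · intro i
          by_cases hi : i = z
          · rw [hi, List.count_eq_zero_of_not_mem hzf, if_neg (by simp [hz])]
          · have : i.val ≠ n + 1 := fun h => hi (Fin.ext h)
            rw [List.count_filter (by simp [hi]), g3]
            congr 1
            simp; omega
      rw [e, this]

end B

section C

theorem count_take_succ {α : Type*} [DecidableEq α] (D : List α) (m : ℕ) (hm : m < D.length) (t : α) :
    (D.take (m + 1)).count t = (D.take m).count t + if D[m] = t then 1 else 0 := by
  rw [← List.take_append_getElem hm, List.count_append]
  simp [List.count_cons]

/-- prefix parity -/
def pp {α : Type*} [DecidableEq α] (D : List α) (m : ℕ) (t : α) : Bool := ((D.take m).count t).bodd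

theorem pp_zero {α : Type*} [DecidableEq α] (D : List α) (t : α) : pp D 0 t = false := by simp [pp]

theorem pp_succ {α : Type*} [DecidableEq α] (D : List α) (m : ℕ) (hm : m < D.length) (t : α) :
    pp D (m + 1) t = xor (pp D m t) (decide (D[m] = t)) := by
  unfold pp
  rw [count_take_succ D m hm, Nat.bodd_add]
  split_ifs with h <;> simp [h]

theorem Good.pp_inj {α : Type*} [DecidableEq α] {D : List α} (h : Good D) {i j : ℕ} (hij : i ≤ j)
    (hj : j ≤ D.length) (he : ∀ t, pp D i t = pp D j t) : i = j := by
  have h1 : (D.take j).drop i <:+: D :=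
    (List.drop_suffix i _).isInfix.trans (List.take_prefix j D).isInfix
  have := h _ h1 ?_
  · have := congrArg List.length this
    simp at this; omega
  · intro t
    have e := he t
    unfold pp at e
    have : (D.take j).count t = (D.take i).count t + ((D.take j).drop i).count t := by
      conv_lhs => rw [← List.take_append_drop i (D.take j), List.count_append, List.take_take,
        min_eq_left hij]
    rw [this, Nat.bodd_add] at e
    generalize (List.count t (List.take i D)).bodd = p at e
    generalize (List.count t (List.drop i (List.take j D))).bodd = q at e ⊢
    revert e; cases p <;> cases q <;> simp

theorem good_of_pp {α : Type*} [DecidableEq α] {D : List α}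
    (h : ∀ i j, i ≤ D.length → j ≤ D.length → (∀ t, pp D i t = pp D j t) → i = j) : Good D := by
  rintro v ⟨p, s, rfl⟩ he
  have := h p.length (p.length + v.length) (by simp) (by simp) ?_
  · exact List.length_eq_zero_iff.1 (by omega)
  · intro t
    unfold pp
    rw [← List.length_append, List.take_left, List.append_assoc, List.take_left, List.count_append,
      Nat.bodd_add, he t]
    simp

theorem pp_ext {α : Type*} [DecidableEq α] {D D' : List α} (hl : D.length = D'.length)
    (h : ∀ m, m ≤ D.length → ∀ t, pp D m t = pp D' m t) : D = D' := by
  refine List.ext_getElem hl (fun m h1 h2 => ?_)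
  have e1 := h (m + 1) h1 D[m]
  have e0 := h m h1.le D[m]
  rw [pp_succ D m h1, pp_succ D' m h2, e0] at e1
  have := Bool.xor_right_inj.1 e1
  simp at this
  exact this.symm

variable {k : ℕ}

def Wd (k : ℕ) (c : Fin k → ℕ) : Set (List (Fin k)) :=
  {D | D.length = 2 ^ k - 1 ∧ Good D ∧ ∀ t, D.count t = c t}

def toG (k : ℕ) (D : List (Fin k)) : Fin 1 → Fin (2 ^ k) → Fin k → Bool :=
  fun _ m t => pp D m.val t

theorem card_filter_getElem (D : List (Fin k)) (n : ℕ) (hn : D.length = n) (t : Fin k) :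
    (Finset.univ.filter fun i : Fin n => D[i.val]'(by omega) = t).card = D.count t := by
  have := Fin.card_filter_univ_eq_vector_get_eq_count t (⟨D, hn⟩ : List.Vector (Fin k) n)
  exact this

theorem isEM {c : Fin k → ℕ} {D : List (Fin k)} (hD : D ∈ Wd k c) :
    IsEquipartingMatrix 1 k c (toG k D) := by
  obtain ⟨h1, h2, h3⟩ := hD
  have hp : 0 < 2 ^ k := by positivity
  have hd : ∀ (i : Fin (2 ^ k - 1)) (t : Fin k),
      toG k D 0 (finLo k i) t ≠ toG k D 0 (finHi k i) t ↔ D[i.val]'(by omega) = t := by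
    intro i t
    simp only [toG, finLo, finHi]
    rw [pp_succ D i.val (by omega)]
    by_cases h : D[i.val]'(by omega) = t <;> simp [h]
  refine ⟨fun i => ?_, fun i h => by omega, fun t => ?_⟩
  · have hi : i = 0 := Subsingleton.elim _ _
    subst hi
    refine ⟨?_, fun i => ⟨D[i.val]'(by omega), (hd i _).2 rfl, fun t ht => ((hd i t).1 ht).symm⟩⟩
    rw [Fintype.bijective_iff_injective_and_card]
    refine ⟨?_, by simp⟩
    intro i j hij
    have he : ∀ t, pp D i.val t = pp D j.val t := fun t => congrFun hij t
    apply Fin.ext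
    rcases le_total i.val j.val with h | h
    · exact h2.pp_inj h (by omega) he
    · exact (h2.pp_inj h (by omega) (fun t => (he t).symm)).symm
  · simp only [Finset.univ_unique, Fin.default_eq_zero, Finset.sum_singleton, grayTransCount]
    rw [← h3 t, ← card_filter_getElem D (2 ^ k - 1) h1 t]
    congr 1
    ext i
    simp only [Finset.mem_filter, Finset.mem_univ, true_and]
    exact hd i t

theorem ofEM {c : Fin k → ℕ} {G : Fin 1 → Fin (2 ^ k) → Fin k → Bool}
    (hG : IsEquipartingMatrix 1 k c G) :
    ∃ D ∈ Wd k c, ∃ β : Fin k → Bool, ∀ i m t, G i m t = xor (β t) (toG k D i m t) := by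
  obtain ⟨hg, -, hc⟩ := hG
  have hp : 0 < 2 ^ k := by positivity
  obtain ⟨hb, hu⟩ := hg 0
  choose d hd hd' using hu
  simp only at hd hd'
  set D := List.ofFn d with hD
  have hl : D.length = 2 ^ k - 1 := by simp [hD]
  have hget : ∀ i : Fin (2 ^ k - 1), D[i.val]'(by omega) = d i := by intro i; simp [hD]
  have hdiff : ∀ i t, G 0 (finLo k i) t ≠ G 0 (finHi k i) t ↔ d i = t := by
    intro i t
    exact ⟨fun h => (hd' i t h).symm, fun h => h ▸ hd i⟩
  have key : ∀ m (hm : m < 2 ^ k) t, G 0 ⟨m, hm⟩ t = xor (G 0 ⟨0, hp⟩ t) (pp D m t) := by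
    intro m
    induction m with
    | zero => intro hm t; simp [pp_zero]
    | succ m ih =>
      intro hm t
      have e := hdiff ⟨m, by omega⟩ t
      have e2 := hget ⟨m, by omega⟩
      simp only at e2
      rw [pp_succ D m (by omega), e2, ← Bool.xor_assoc, ← ih (by omega) t]
      simp only [finLo, finHi] at e
      by_cases h : d ⟨m, by omega⟩ = t
      · simp only [h, decide_true, Bool.xor_true]
        have := e.2 h
        revert this
        generalize G 0 ⟨m, by omega⟩ t = p
        generalize G 0 ⟨m + 1, hm⟩ t = q
        cases p <;> cases q <;> simp
      · simp only [h, decide_false, Bool.xor_false]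
        have := mt e.1 h
        push Not at this
        exact this.symm
  refine ⟨D, ⟨hl, ?_, ?_⟩, G 0 ⟨0, hp⟩, ?_⟩
  · apply good_of_pp
    intro i j hi hj he
    have hi' : i < 2 ^ k := by omega
    have hj' : j < 2 ^ k := by omega
    have : G 0 ⟨i, hi'⟩ = G 0 ⟨j, hj'⟩ := by
      ext t; rw [key i hi', key j hj', he t]
    exact congrArg Fin.val (hb.1 this)
  · intro t
    have := hc t
    simp only [Finset.univ_unique, Fin.default_eq_zero, Finset.sum_singleton, grayTransCount] at this
    rw [← this, ← card_filter_getElem D (2 ^ k - 1) hl t]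
    congr 1
    ext i
    simp only [Finset.mem_filter, Finset.mem_univ, true_and, hget]
    exact (hdiff i t).symm
  · intro i m t
    have hi : i = 0 := Subsingleton.elim _ _
    subst hi
    exact key m.val m.isLt t

theorem EMEquiv_equivalence (j k : ℕ) (c : Fin k → ℕ) :
    Equivalence (fun G G' : {G // IsEquipartingMatrix j k c G} => EMEquiv j k c G.1 G'.1) := by
  refine ⟨fun G => ⟨fun _ => false, 1, by simp, by simp⟩, ?_, ?_⟩
  · rintro G G' ⟨β, τ, h1, h2⟩
    refine ⟨fun t => β (τ.symm t), τ.symm, fun t => ?_, fun i m t => ?_⟩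
    · have := h1 (τ.symm t); simpa using this.symm
    · rw [h2]; simp
  · rintro G G' G'' ⟨β, τ, h1, h2⟩ ⟨β', τ', h1', h2'⟩
    refine ⟨fun t => xor (β' t) (β (τ' t)), τ'.trans τ, fun t => ?_, fun i m t => ?_⟩
    · simp [h1, h1']
    · rw [h2', h2]; simp

theorem pp_map (σ : Equiv.Perm (Fin k)) (D : List (Fin k)) (m : ℕ) (t : Fin k) :
    pp (D.map σ) m t = pp D m (σ.symm t) := by
  unfold pp
  rw [← List.map_take, count_map_perm]

theorem equiv_iff {c : Fin k → ℕ} {D D' : List (Fin k)} (hD : D ∈ Wd k c) (hD' : D' ∈ Wd k c) :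
    EMEquiv 1 k c (toG k D) (toG k D') ↔
      ∃ σ : Equiv.Perm (Fin k), (∀ t, c (σ t) = c t) ∧ D' = D.map σ := by
  have hp : 0 < 2 ^ k := by positivity
  constructor
  · rintro ⟨β, τ, h1, h2⟩
    refine ⟨τ.symm, fun t => by have := h1 (τ.symm t); simpa using this.symm, ?_⟩
    have hβ : ∀ t, β t = false := by
      intro t
      have := h2 0 ⟨0, hp⟩ t
      simpa [toG, pp_zero] using this
    refine pp_ext (by simp [hD.1, hD'.1]) (fun m hm t => ?_)
    rw [hD'.1] at hm
    have := h2 0 ⟨m, by omega⟩ t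
    rw [hβ t] at this
    simpa [toG, pp_map] using this
  · rintro ⟨σ, h1, rfl⟩
    refine ⟨fun _ => false, σ.symm, fun t => by have := h1 (σ.symm t); simpa using this.symm, ?_⟩
    intro i m t
    simp [toG, pp_map]

theorem card_eq {c : Fin k → ℕ} {a b : Fin k} (hab : a ≠ b)
    (hst : ∀ σ : Equiv.Perm (Fin k), (∀ t, c (σ t) = c t) ↔ σ = 1 ∨ σ = Equiv.swap a b)
    (ha : c a ≠ 0) : (Wd k c).ncard = 2 * numEquivClasses 1 k c := by
  classical
  have hfin : (Wd k c).Finite := finite_len (2 ^ k - 1) (fun D hD => hD.1)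
  have : Finite (Wd k c) := hfin
  unfold numEquivClasses
  set Q := Quot (fun G G' : {G // IsEquipartingMatrix 1 k c G} => EMEquiv 1 k c G.1 G'.1) with hQ
  let φ : Wd k c → Q := fun D => Quot.mk _ ⟨toG k D.1, isEM D.2⟩
  have hmap : ∀ D ∈ Wd k c, D.map (Equiv.swap a b) ∈ Wd k c := by
    rintro D ⟨h1, h2, h3⟩
    refine ⟨by simpa, h2.map _, fun t => ?_⟩
    rw [count_map_perm, h3, Equiv.symm_swap]
    exact (hst _).2 (Or.inr rfl) t
  have hφ : ∀ D D' : Wd k c, φ D = φ D' ↔ D'.1 = D.1 ∨ D'.1 = D.1.map (Equiv.swap a b) := by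
    intro D D'
    have e1 : φ D = φ D' ↔ EMEquiv 1 k c (toG k D.1) (toG k D'.1) :=
      (EMEquiv_equivalence 1 k c).quot_mk_eq_iff _ _
    rw [e1, equiv_iff D.2 D'.2]
    constructor
    · rintro ⟨σ, h1, h2⟩
      rcases (hst σ).1 h1 with rfl | rfl
      · left; simpa using h2
      · right; exact h2
    · rintro (h | h)
      · exact ⟨1, by simp, by simpa using h⟩
      · exact ⟨_, (hst _).2 (Or.inr rfl), h⟩
  have hsurj : Function.Surjective φ := by
    rintro ⟨G, hG⟩
    obtain ⟨D, hD, β, hβ⟩ := ofEM hG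
    refine ⟨⟨D, hD⟩, Quot.sound ⟨β, 1, by simp, by simpa using hβ⟩⟩
  have : Finite Q := Finite.of_surjective φ hsurj
  have := Fintype.ofFinite Q
  have hfib : ∀ q : Q, Nat.card {D // φ D = q} = 2 := by
    intro q
    obtain ⟨D, rfl⟩ := hsurj q
    have : {D' | φ D' = φ D} = {D, ⟨D.1.map (Equiv.swap a b), hmap _ D.2⟩} := by
      ext D'
      simp only [Set.mem_ofPred_eq, Set.mem_insert_iff, Set.mem_singleton_iff, Subtype.ext_iff]
      rw [eq_comm, hφ]
    have h2 : {D' | φ D' = φ D}.ncard = 2 := by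
      rw [this, Set.ncard_pair]
      intro h
      have h := congrArg Subtype.val h
      refine map_swap_ne hab (Or.inl ?_) h.symm
      rw [← List.count_pos_iff, D.2.2.2 a]; omega
    exact h2
  have h := Nat.card_congr (Equiv.sigmaFiberEquiv φ)
  rw [Nat.card_sigma] at h
  simp only [hfib] at h
  rw [← Nat.card_coe_set_eq, ← h]
  simp [Nat.card_eq_fintype_card, mul_comm]

theorem sum_count (D : List (Fin k)) : ∑ t, D.count t = D.length := by
  induction D with
  | nil => simp
  | cons x D ih => simp [List.count_cons, Finset.sum_add_distrib, ih]

/-- the tuple -/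
def cc (n : ℕ) (t : Fin (n + 3)) : ℕ :=
  if t.val = 0 then 1 else if t.val ≤ n then 4 * 2 ^ (t.val - 1) else 2 * 2 ^ n + 1

theorem cc_inj (n : ℕ) (s t : Fin (n + 3)) (ht : t.val ≤ n) (h : cc n s = cc n t) : s = t := by
  unfold cc at h
  apply Fin.ext
  have h1 : 0 < 2 ^ n := by positivity
  have h2 : 0 < 2 ^ (s.val - 1) := by positivity
  have h3 : 0 < 2 ^ (t.val - 1) := by positivity
  split_ifs at h <;> try omega
  have : 2 ^ (s.val - 1) = 2 ^ (t.val - 1) := by omega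
  have := Nat.pow_right_injective (le_refl 2) this
  omega

theorem cc_stab (n : ℕ) (a b : Fin (n + 3)) (ha : a.val = n + 1) (hb : b.val = n + 2)
    (σ : Equiv.Perm (Fin (n + 3))) :
    (∀ t, cc n (σ t) = cc n t) ↔ σ = 1 ∨ σ = Equiv.swap a b := by
  have hab : a ≠ b := by intro h; subst h; omega
  have hcab : cc n a = cc n b := by simp [cc, ha, hb]
  have hcase : ∀ t : Fin (n + 3), t.val ≤ n ∨ t = a ∨ t = b := by
    intro t; simp only [Fin.ext_iff]; omega
  constructor
  · intro h
    have h1 : ∀ t : Fin (n + 3), t.val ≤ n → σ t = t := fun t ht => cc_inj n _ _ ht (h t)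
    have h2 : ∀ t : Fin (n + 3), ¬ t.val ≤ n → ¬ (σ t).val ≤ n := by
      intro t ht h3
      have := σ.injective (h1 _ h3)
      rw [this] at h3; exact ht h3
    have ha' := (hcase (σ a)).resolve_left (h2 a (by omega))
    have hb' := (hcase (σ b)).resolve_left (h2 b (by omega))
    rcases ha' with e | e
    · left
      have e' : σ b = b := hb'.resolve_left (fun h => hab (σ.injective (e.trans h.symm)))
      ext1 t
      rcases hcase t with ht | rfl | rfl
      · simp [h1 t ht]
      · simp [e]
      · simp [e']
    · right
      have e' : σ b = a := hb'.resolve_right (fun h => hab (σ.injective (e.trans h.symm)))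
      ext1 t
      rcases hcase t with ht | rfl | rfl
      · rw [h1 t ht, Equiv.swap_apply_of_ne_of_ne]
        · rintro rfl; omega
        · rintro rfl; omega
      · simp [e]
      · simp [e']
  · rintro (rfl | rfl) t
    · simp
    · rcases eq_or_ne t a with rfl | h1
      · simp [hcab]
      · rcases eq_or_ne t b with rfl | h2
        · simp [hcab]
        · rw [Equiv.swap_apply_of_ne_of_ne h1 h2]

theorem Wd_eq (n : ℕ) (a b x : Fin (n + 3)) (ha : a.val = n + 1) (hb : b.val = n + 2)
    (hx : x.val = 0) :
    Wd (n + 3) (cc n) = SS a b x (fun i => 2 ^ (i.val - 1)) (2 ^ (n + 1) - 1) (2 ^ n) := by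
  have hp : 0 < 2 ^ n := by positivity
  have e1 : 2 ^ (n + 1) = 2 * 2 ^ n := by ring
  have e3 : 2 ^ (n + 3) = 8 * 2 ^ n := by ring
  have ea : cc n a = 2 * 2 ^ n + 1 := by simp [cc, ha]
  have eb : cc n b = 2 * 2 ^ n + 1 := by simp [cc, hb]
  have ex : cc n x = 1 := by simp [cc, hx]
  have ei : ∀ i, i ≠ a → i ≠ b → i ≠ x → cc n i = 4 * 2 ^ (i.val - 1) := by
    intro i h1 h2 h3
    simp only [ne_eq, Fin.ext_iff] at h1 h2 h3
    rw [cc, if_neg (by omega), if_pos (by omega)]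
  ext D
  constructor
  · rintro ⟨h1, h2, h3⟩
    exact ⟨by omega, h2, by rw [h3, ea], by rw [h3, eb], by rw [h3, ex],
      fun i i1 i2 i3 => by rw [h3, ei i i1 i2 i3]⟩
  · rintro ⟨h1, h2, h3, h4, h5, h6⟩
    refine ⟨by omega, h2, fun t => ?_⟩
    by_cases ta : t = a
    · rw [ta, h3, ea]
    by_cases tb : t = b
    · rw [tb, h4, eb]
    by_cases tx : t = x
    · rw [tx, h5, ex]
    rw [h6 t ta tb tx, ei t ta tb tx]

theorem UU_uniq (n : ℕ) (a b x : Fin (n + 3)) (ha : a.val = n + 1) (hb : b.val = n + 2)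
    (hx : x.val = 0) :
    ∃! u, u ∈ UU a b x (fun i => 2 ^ (i.val - 1)) (2 ^ (n + 1) - 1) (2 ^ n) := by
  refine (existsUnique_congr (fun u => ?_)).1 (uniq (n + 3) (n + 1) (by omega))
  refine and_congr_right (fun _ => and_congr_right (fun _ => ?_))
  constructor
  · intro h
    refine ⟨?_, ?_, ?_, ?_⟩
    · rw [h, if_pos (by omega), ha]; simp
    · rw [h, if_neg (by omega)]
    · rw [h, if_neg (by omega)]
    · intro i h1 h2 h3
      simp only [ne_eq, Fin.ext_iff] at h1 h2 h3
      rw [h, if_pos (by omega)]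
  · rintro ⟨h1, h2, h3, h4⟩ i
    by_cases ta : i = a
    · rw [ta, h1, if_pos (by omega), ha]; simp
    by_cases tb : i = b
    · rw [tb, h2, if_neg (by omega)]
    by_cases tx : i = x
    · rw [tx, h3, if_neg (by omega)]
    rw [h4 i ta tb tx, if_pos]
    simp only [Fin.ext_iff] at ta tb tx
    omega

theorem case_big (n : ℕ) : 
    ∃ c : Fin (n + 3) → ℕ, (∑ t, c t) = 2 ^ (n + 3) - 1 ∧
      Odd (numEquivClasses 1 (n + 3) c) ∧
      Finset.univ.sup c ≤ 2 ^ (n + 3 - 2) + 1 := by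
  let a : Fin (n + 3) := ⟨n + 1, by omega⟩
  let b : Fin (n + 3) := ⟨n + 2, by omega⟩
  let x : Fin (n + 3) := ⟨0, by omega⟩
  have hab : a ≠ b := by simp [a, b]
  have hxa : x ≠ a := by simp [a, x]
  have hxb : x ≠ b := by simp [b, x]
  have hcard : (Wd (n + 3) (cc n)).ncard % 4 = 2 := by
    rw [Wd_eq n a b x rfl rfl rfl, SS_mod hab hxa hxb, TT_mod hab hxa hxb (UU_uniq n a b x rfl rfl rfl)]
  refine ⟨cc n, ?_, ?_, ?_⟩
  · have hne : (Wd (n + 3) (cc n)).Nonempty := by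
      by_contra h
      rw [Set.not_nonempty_iff_eq_empty] at h
      rw [h] at hcard; simp at hcard
    obtain ⟨D, h1, h2, h3⟩ := hne
    rw [← h1, ← sum_count]
    simp only [h3]
  · rw [card_eq hab (cc_stab n a b rfl rfl) (by simp [cc, a])] at hcard
    rw [Nat.odd_iff]; omega
  · refine Finset.sup_le (fun t _ => ?_)
    have e : 2 ^ (n + 3 - 2) = 2 * 2 ^ n := by
      rw [show n + 3 - 2 = n + 1 by omega]; ring
    rw [e]
    unfold cc
    split_ifs with h1 h2
    · omega
    · have : 2 ^ (t.val - 1 + 1) ≤ 2 ^ n := Nat.pow_le_pow_right (by omega) (by omega)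
      rw [pow_succ] at this
      omega
    · omega

theorem case_two : 
    ∃ c : Fin 2 → ℕ, (∑ t, c t) = 2 ^ 2 - 1 ∧
      Odd (numEquivClasses 1 2 c) ∧
      Finset.univ.sup c ≤ 2 ^ (2 - 2) + 1 := by
  refine ⟨![2, 1], by decide, ?_, by decide⟩
  have hD0 : [0, 1, 0] ∈ Wd 2 ![2, 1] := by
    refine ⟨rfl, ?_, by decide⟩
    refine good_mid (u := [0]) (v := [0]) ?_ ?_ (by decide) (by decide)
    all_goals
      intro v hv he
      rcases List.infix_cons_iff.1 hv with h | h
      · match v, h, he with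
        | [], _, _ => rfl
        | [y], _, he => have := he y; simp at this
        | y :: z :: t, h, _ => have := h.length_le; simp at this
      · simpa using h
  have huniq : ∀ D ∈ Wd 2 ![2, 1], D = [0, 1, 0] := by
    rintro D ⟨h1, h2, h3⟩
    match D, h1, h2, h3 with
    | [x, y, z], _, h2, h3 =>
      have e0 := h3 0
      have e1 := h3 1
      have n1 : x ≠ y := by
        intro h
        have := h2 [x, y] ⟨[], [z], rfl⟩ (by
          intro t; subst h; by_cases ht : x = t <;> simp [List.count_cons, ht])
        simp at this
      have n2 : y ≠ z := by
        intro h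
        have := h2 [y, z] ⟨[x], [], rfl⟩ (by
          intro t; subst h; by_cases ht : y = t <;> simp [List.count_cons, ht])
        simp at this
      clear h2 h3
      revert e0 e1 n1 n2
      revert x y z
      decide
  have : numEquivClasses 1 2 ![2, 1] = 1 := by
    unfold numEquivClasses
    rw [Nat.card_eq_one_iff_unique]
    have hall : ∀ q : Quot (fun G G' : {G // IsEquipartingMatrix 1 2 ![2, 1] G} =>
        EMEquiv 1 2 ![2, 1] G.1 G'.1), q = Quot.mk _ ⟨toG 2 [0, 1, 0], isEM hD0⟩ := by
      rintro ⟨G, hG⟩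
      obtain ⟨D, hD, β, hβ⟩ := ofEM hG
      have := huniq D hD
      subst this
      exact (Quot.sound ⟨β, 1, by simp, by simpa using hβ⟩).symm
    exact ⟨⟨fun p q => (hall p).trans (hall q).symm⟩, ⟨Quot.mk _ ⟨toG 2 [0, 1, 0], isEM hD0⟩⟩⟩
  rw [this]; decide

end C

/-- `E(1, k) ≤ 2^(k-2) + 1`: there is a tuple `c` with `∑ c = 2^k - 1`, an odd number
of equivalence classes of `c`-equiparting matrices, and `max c ≤ 2^(k-2) + 1`. -/
theorem E_one_upper_bound (k : ℕ) (hk : 2 ≤ k) :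
    ∃ c : Fin k → ℕ, (∑ t, c t) = 2 ^ k - 1 ∧
      Odd (numEquivClasses 1 k c) ∧
      Finset.univ.sup c ≤ 2 ^ (k - 2) + 1 := by
  rcases Nat.lt_or_ge k 3 with h | h
  · obtain rfl : k = 2 := by omega
    exact case_two
  · obtain ⟨n, rfl⟩ : ∃ n, k = n + 3 := ⟨k - 3, by omega⟩
    exact case_big n
end

section
/- Let k ≥ 2, n ≥ 0 and 1 ≤ r ≤ 2^n be integers. Then E(2^n + r, k) = 2^{n+k−1} + r. -/
open Finset in
theorem perm_of_map_eq {k : ℕ} (f g : Fin k → ℕ)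
    (h : (univ : Finset (Fin k)).val.map f = (univ : Finset (Fin k)).val.map g) :
    ∃ σ : Equiv.Perm (Fin k), ∀ t, g (σ t) = f t := by
  classical
  have key : ∀ y, Nonempty ({t // f t = y} ≃ {t // g t = y}) := by
    intro y
    have h1 := congrArg (Multiset.count y) h
    rw [Multiset.count_map, Multiset.count_map] at h1
    refine ⟨Fintype.equivOfCardEq ?_⟩
    rw [Fintype.card_subtype, Fintype.card_subtype]
    simp only [Finset.card_def, Finset.filter_val]
    simpa [eq_comm] using h1
  let e := fun y => (key y).some
  exact ⟨Equiv.ofFiberEquiv e, fun t => Equiv.ofFiberEquiv_map e t⟩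

theorem map_eq_of_perm {k : ℕ} (f g : Fin k → ℕ) (σ : Equiv.Perm (Fin k))
    (h : ∀ t, g (σ t) = f t) :
    (Finset.univ : Finset (Fin k)).val.map f = (Finset.univ : Finset (Fin k)).val.map g := by
  have : f = g ∘ σ := by funext t; exact (h t).symm
  rw [this, ← Multiset.map_map, Multiset.map_univ_val_equiv]

/-- value multiset of a function -/
def vals {k : ℕ} (f : Fin k → ℕ) : Multiset ℕ := (Finset.univ : Finset (Fin k)).val.map f

theorem mem_vals {k : ℕ} (f : Fin k → ℕ) (y : ℕ) : y ∈ vals f ↔ ∃ t, f t = y := by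
  simp [vals]

/-- weighted total -/
def tot {k : ℕ} {ι : Type} [Fintype ι] (w : ι → ℕ) (π : ι → Equiv.Perm (Fin k)) (t : Fin k) : ℕ :=
  ∑ i, w i * 2 ^ ((π i t : Fin k) : ℕ)

abbrev ZZ (k : ℕ) {ι : Type} [Fintype ι] (w : ι → ℕ) (i0 : ι) (C : Multiset ℕ) : Type :=
  {π : ι → Equiv.Perm (Fin k) // π i0 = 1 ∧ vals (tot w π) = C}

noncomputable instance (k : ℕ) {ι : Type} [Fintype ι] (w : ι → ℕ) (i0 : ι) (C : Multiset ℕ) :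
    Fintype (ZZ k w i0 C) := by
  classical
  exact Fintype.ofFinite _

noncomputable def Zc (k : ℕ) {ι : Type} [Fintype ι] (w : ι → ℕ) (i0 : ι) (C : Multiset ℕ) : ℕ :=
  Nat.card (ZZ k w i0 C)

theorem vals_tot_mul {k : ℕ} {ι : Type} [Fintype ι] (w : ι → ℕ) (π : ι → Equiv.Perm (Fin k))
    (σ : Equiv.Perm (Fin k)) : vals (tot w (fun i => π i * σ)) = vals (tot w π) := by
  apply map_eq_of_perm _ _ σ
  intro t
  simp [tot]

theorem Zc_base {k : ℕ} {ι : Type} [Fintype ι] (w : ι → ℕ) (i0 i1 : ι) (C : Multiset ℕ) :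
    Zc k w i0 C = Zc k w i1 C := by
  refine Nat.card_congr
    { toFun := fun π => ⟨fun i => π.1 i * (π.1 i1)⁻¹, by simp, by
        rw [vals_tot_mul]; exact π.2.2⟩
      invFun := fun π => ⟨fun i => π.1 i * (π.1 i0)⁻¹, by simp, by
        rw [vals_tot_mul]; exact π.2.2⟩
      left_inv := ?_
      right_inv := ?_ }
  · intro π
    apply Subtype.ext
    funext i
    have := π.2.1
    simp [this]
  · intro π
    apply Subtype.ext
    funext i
    have := π.2.1
    simp [this]

theorem card_fix_end {X : Type*} [Finite X] (f : X → X) (m : ℕ)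
    (hf : ∀ x, f^[2 ^ m] x = x) :
    Nat.card X ≡ Nat.card {x // f x = x} [MOD 2] := by
  classical
  have := Fintype.ofFinite X
  have h2 : Fact (Nat.Prime 2) := ⟨Nat.prime_two⟩
  let F : Function.End X := f
  have hF : F ^ (2 ^ m) = 1 := by
    funext x
    have : ∀ a : ℕ, F ^ a = f^[a] := by
      intro a
      induction a with
      | zero => rfl
      | succ a ih => rw [pow_succ, ih]; rfl
    rw [this, hf]; rfl
  have := Equiv.Perm.card_fixedPoints_modEq (p := 2) hF
  rw [← Nat.card_eq_fintype_card, ← Nat.card_eq_fintype_card] at this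
  exact this

theorem tot_comp {k : ℕ} {ι κ : Type} [Fintype ι] [Fintype κ] [DecidableEq κ] (p : ι → κ)
    (w : ι → ℕ) (w' : κ → ℕ) (hw' : ∀ y, w' y = ∑ x with p x = y, w x)
    (π : κ → Equiv.Perm (Fin k)) : tot w (fun i => π (p i)) = tot w' π := by
  funext t
  unfold tot
  rw [← Finset.sum_fiberwise (s := Finset.univ) (g := p)]
  apply Finset.sum_congr rfl
  intro y _
  rw [hw', Finset.sum_mul]
  apply Finset.sum_congr rfl
  intro x hx
  simp at hx
  simp [hx]

theorem Zc_merge {k : ℕ} {ι κ : Type} [Fintype ι] [Fintype κ] [DecidableEq κ] (p : ι → κ)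
    (hp : Function.Surjective p) (ρ : Equiv.Perm ι) (m : ℕ) (hρ : ∀ x, ρ^[2 ^ m] x = x)
    (i0 : ι) (h0 : ρ i0 = i0) (w : ι → ℕ) (w' : κ → ℕ) (hw : ∀ x, w (ρ x) = w x)
    (hpρ : ∀ x, p (ρ x) = p x) (horb : ∀ x y, p x = p y → ∃ a : ℕ, ρ^[a] x = y)
    (hw' : ∀ y, w' y = ∑ x with p x = y, w x) (C : Multiset ℕ) :
    Zc k w i0 C ≡ Zc k w' (p i0) C [MOD 2] := by
  have htot : ∀ π : ι → Equiv.Perm (Fin k), tot w (fun i => π (ρ i)) = tot w π := by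
    intro π
    funext t
    unfold tot
    rw [← Equiv.sum_comp ρ (fun i => w i * 2 ^ ((π i t : Fin k) : ℕ))]
    simp [hw]
  let f : ZZ k w i0 C → ZZ k w i0 C := fun π => ⟨fun i => π.1 (ρ i), by
    simp only [h0]; exact π.2.1, by rw [htot]; exact π.2.2⟩
  have hfa : ∀ (a : ℕ) (π : ZZ k w i0 C) (i : ι), (f^[a] π).1 i = π.1 (ρ^[a] i) := by
    intro a
    induction a with
    | zero => intro π i; rfl
    | succ a ih =>
      intro π i
      rw [Function.iterate_succ_apply, ih, Function.iterate_succ_apply']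
  have h1 := card_fix_end f m (by
    intro π
    apply Subtype.ext
    funext i
    rw [hfa, hρ])
  refine h1.trans ?_
  have : Nat.card {π // f π = π} = Zc k w' (p i0) C := by
    symm
    apply Nat.card_eq_of_bijective
      (fun π : ZZ k w' (p i0) C => (⟨⟨fun i => π.1 (p i), π.2.1, by
        rw [tot_comp p w w' hw']; exact π.2.2⟩, by
          apply Subtype.ext; funext i; simp [f, hpρ]⟩ : {π : ZZ k w i0 C // f π = π}))
    constructor
    · intro π π' h
      apply Subtype.ext
      funext y
      obtain ⟨x, rfl⟩ := hp y
      have := congrArg (fun q => q.1.1 x) h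
      exact this
    · rintro ⟨π, hπ⟩
      have hc : ∀ x y, p x = p y → π.1 x = π.1 y := by
        intro x y hxy
        obtain ⟨a, rfl⟩ := horb x y hxy
        rw [← hfa]
        have : f^[a] π = π := Function.iterate_fixed hπ a
        rw [this]
      obtain ⟨q, hq⟩ := hp.hasRightInverse
      have hpq : ∀ i, π.1 (q (p i)) = π.1 i := fun i => hc _ _ (hq (p i))
      refine ⟨⟨fun y => π.1 (q y), ?_, ?_⟩, ?_⟩
      · exact (hpq i0).trans π.2.1
      · rw [← tot_comp p w w' hw']
        simp only [hpq]
        exact π.2.2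
      · apply Subtype.ext
        apply Subtype.ext
        funext i
        exact hpq i
  rw [this]

theorem Zc_reindex {k : ℕ} {ι κ : Type} [Fintype ι] [Fintype κ] (e : ι ≃ κ) (i0 : ι)
    (w : ι → ℕ) (w' : κ → ℕ) (hw : ∀ x, w' (e x) = w x) (C : Multiset ℕ) :
    Zc k w i0 C ≡ Zc k w' (e i0) C [MOD 2] := by
  classical
  refine Zc_merge e e.surjective 1 0 (by simp) i0 rfl w w' (by simp) (by simp)
    (fun x y h => ⟨0, e.injective h⟩) ?_ C
  intro y
  obtain ⟨x, rfl⟩ := e.surjective y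
  rw [hw]
  have : (Finset.univ.filter fun x' => e x' = e x) = {x} := by ext; simp
  rw [this]; simp

def ow {κ : Type} (a : ℕ) (w : κ → ℕ) : Option κ → ℕ := fun o => o.elim a w

theorem rot_iter (N : ℕ) (a : ℕ) (x : ZMod N) :
    (Equiv.addRight (1 : ZMod N))^[a] x = x + a := by
  induction a generalizing x with
  | zero => simp
  | succ a ih => rw [Function.iterate_succ_apply, ih]; simp; ring

theorem Zc_m1 {k n : ℕ} {κ : Type} [Fintype κ] (w : κ → ℕ) (i : κ) (C : Multiset ℕ) :
    Zc k (Sum.elim (fun _ : ZMod (2 ^ n) => 1) w) (Sum.inr i) C ≡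
      Zc k (ow (2 ^ n) w) (some i) C [MOD 2] := by
  classical
  let p : ZMod (2 ^ n) ⊕ κ → Option κ := Sum.elim (fun _ => none) some
  have hl : ∀ (a : ℕ) (x : ZMod (2 ^ n)),
      (Equiv.sumCongr (Equiv.addRight (1 : ZMod (2 ^ n))) (Equiv.refl κ))^[a] (Sum.inl x)
        = Sum.inl (x + a) := by
    intro a x
    rw [← rot_iter]
    induction a generalizing x with
    | zero => rfl
    | succ a ih => rw [Function.iterate_succ_apply, Function.iterate_succ_apply, ← ih]; rfl
  have hr : ∀ (a : ℕ) (x : κ),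
      (Equiv.sumCongr (Equiv.addRight (1 : ZMod (2 ^ n))) (Equiv.refl κ))^[a] (Sum.inr x)
        = Sum.inr x := by
    intro a x
    apply Function.iterate_fixed
    rfl
  refine Zc_merge p ?_ (Equiv.sumCongr (Equiv.addRight 1) (Equiv.refl κ)) n ?_ (Sum.inr i) rfl
    _ _ ?_ ?_ ?_ ?_ C
  · rintro (_ | y)
    · exact ⟨Sum.inl 0, rfl⟩
    · exact ⟨Sum.inr y, rfl⟩
  · rintro (x | x)
    · rw [hl]
      have : ((2 ^ n : ℕ) : ZMod (2 ^ n)) = 0 := ZMod.natCast_self _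
      rw [this, add_zero]
    · rw [hr]
  · rintro (x | x) <;> rfl
  · rintro (x | x) <;> rfl
  · rintro (x | x) (y | y) h
    · refine ⟨(y - x).val, ?_⟩
      rw [hl, ZMod.natCast_zmod_val]; simp
    · simp [p] at h
    · simp [p] at h
    · simp [p] at h
      exact ⟨0, by simp [h]⟩
  · rintro (_ | y)
    · simp [ow, p, Finset.sum_filter, ZMod.card]
    · simp [ow, p, Finset.sum_filter]

theorem Zc_m3 {k n a : ℕ} (C : Multiset ℕ) :
    Zc k (ow a (fun _ : ZMod (2 ^ n) => 1)) none C ≡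
      Zc k (ow a (fun _ : Unit => 2 ^ n)) none C [MOD 2] := by
  classical
  let p : Option (ZMod (2 ^ n)) → Option Unit := Option.map (fun _ => ())
  have hl : ∀ (a : ℕ) (x : ZMod (2 ^ n)),
      (Equiv.optionCongr (Equiv.addRight (1 : ZMod (2 ^ n))))^[a] (some x)
        = some (x + a) := by
    intro a x
    rw [← rot_iter]
    induction a generalizing x with
    | zero => rfl
    | succ a ih => rw [Function.iterate_succ_apply, Function.iterate_succ_apply, ← ih]; rfl
  have hr : ∀ (a : ℕ),
      (Equiv.optionCongr (Equiv.addRight (1 : ZMod (2 ^ n))))^[a] none = none := by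
    intro a
    apply Function.iterate_fixed
    rfl
  refine Zc_merge p ?_ (Equiv.optionCongr (Equiv.addRight 1)) n ?_ none rfl
    _ _ ?_ ?_ ?_ ?_ C
  · rintro (_ | y)
    · exact ⟨none, rfl⟩
    · exact ⟨some 0, rfl⟩
  · rintro (_ | x)
    · rw [hr]
    · rw [hl]
      have : ((2 ^ n : ℕ) : ZMod (2 ^ n)) = 0 := ZMod.natCast_self _
      rw [this, add_zero]
  · rintro (_ | x) <;> rfl
  · rintro (_ | x) <;> rfl
  · rintro (_ | x) (_ | y) h
    · exact ⟨0, rfl⟩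
    · simp [p] at h
    · simp [p] at h
    · refine ⟨(y - x).val, ?_⟩
      rw [hl, ZMod.natCast_zmod_val]; simp
  · rintro (_ | y)
    · simp [ow, p, Finset.sum_filter]
    · simp [ow, p, Finset.sum_filter, ZMod.card]

theorem Zc_m2 {k a : ℕ} {κ : Type} [Fintype κ] (C : Multiset ℕ) :
    Zc k (ow a (fun _ : κ × Bool => 1)) none C ≡
      Zc k (ow a (fun _ : κ => 2)) none C [MOD 2] := by
  classical
  let p : Option (κ × Bool) → Option κ := Option.map Prod.fst
  refine Zc_merge p ?_ (Equiv.optionCongr (Equiv.prodCongr (Equiv.refl κ) Equiv.boolNot)) 1 ?_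
    none rfl _ _ ?_ ?_ ?_ ?_ C
  · rintro (_ | y)
    · exact ⟨none, rfl⟩
    · exact ⟨some (y, true), rfl⟩
  · rintro (_ | ⟨x, _ | _⟩) <;> rfl
  · rintro (_ | x) <;> rfl
  · rintro (_ | x) <;> rfl
  · rintro (_ | ⟨x, b⟩) (_ | ⟨y, b'⟩) h
    · exact ⟨0, rfl⟩
    · simp [p] at h
    · simp [p] at h
    · simp [p] at h
      subst h
      by_cases hb : b = b'
      · exact ⟨0, by simp [hb]⟩
      · refine ⟨1, ?_⟩
        cases b <;> cases b' <;> simp_all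
  · rintro (_ | y)
    · simp [ow, p, Finset.sum_filter]
    · simp [ow, p, Finset.sum_filter]
      rw [show (Finset.univ.filter fun x : κ × Bool => x = (y, false) ∨ x = (y, true))
        = {(y, false), (y, true)} by ext; simp]
      simp

theorem Zc_red1 {k n r j : ℕ} {κ : Type} [Fintype κ] (hκ : Fintype.card κ = r) (hr : 1 ≤ r)
    (hj : j = 2 ^ n + r)
    (i0 : Fin j) (C : Multiset ℕ) :
    Zc k (fun _ : Fin j => 1) i0 C ≡ Zc k (ow (2 ^ n) (fun _ : κ => 1)) none C [MOD 2] := by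
  have hc : Fintype.card (Fin j) = Fintype.card (ZMod (2 ^ n) ⊕ κ) := by
    simp [ZMod.card, hκ, hj]
  have e := Fintype.equivOfCardEq hc
  have hne : Nonempty κ := Fintype.card_pos_iff.mp (by omega)
  obtain ⟨i⟩ := hne
  have h1 := Zc_reindex (k := k) e i0 (fun _ => 1)
    (Sum.elim (fun _ : ZMod (2 ^ n) => 1) (fun _ : κ => 1)) (by
      intro x; rcases e x with y | y <;> rfl) C
  rw [Zc_base _ _ (Sum.inr i)] at h1
  refine h1.trans ((Zc_m1 _ i C).trans ?_)
  rw [Zc_base _ _ none]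

theorem Zc_red2 {k n r j : ℕ} (hr : 1 ≤ r) (hj : j = 2 ^ n + 2 * r)
    (i0 : Fin j) (C : Multiset ℕ) :
    Zc k (fun _ : Fin j => 1) i0 C ≡ Zc k (ow (2 ^ n) (fun _ : Fin r => 2)) none C [MOD 2] :=
  (Zc_red1 (κ := Fin r × Bool) (r := 2 * r) (by simp [mul_comm]) (by omega) hj i0 C).trans
    (Zc_m2 C)

theorem Zc_red3 {k n j : ℕ} (hj : j = 2 ^ n + 2 ^ n)
    (i0 : Fin j) (C : Multiset ℕ) :
    Zc k (fun _ : Fin j => 1) i0 C ≡ Zc k (ow (2 ^ n) (fun _ : Unit => 2 ^ n)) none C [MOD 2] :=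
  (Zc_red1 (κ := ZMod (2 ^ n)) (r := 2 ^ n) (by simp [ZMod.card]) Nat.one_le_two_pow hj i0 C).trans
    (Zc_m3 C)

theorem Zc_pos {k : ℕ} {ι : Type} [Fintype ι] (w : ι → ℕ) (i0 : ι) (C : Multiset ℕ)
    (h : Odd (Zc k w i0 C)) : ∃ π : ι → Equiv.Perm (Fin k), π i0 = 1 ∧ vals (tot w π) = C := by
  have h1 : Zc k w i0 C ≠ 0 := by
    intro h0; rw [h0] at h; simp at h
  have := (Nat.card_ne_zero.mp h1).1
  obtain ⟨π⟩ := this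
  exact ⟨π.1, π.2⟩

theorem odd_congr {a b : ℕ} (h : a ≡ b [MOD 2]) : Odd a ↔ Odd b := by
  rw [Nat.odd_iff, Nat.odd_iff]; unfold Nat.ModEq at h; rw [h]

theorem Zc_lower {k n r j : ℕ} (hk : 1 ≤ k) (hr : 1 ≤ r) (hj : j = 2 ^ n + r) (i0 : Fin j)
    (C : Multiset ℕ) (h : Odd (Zc k (fun _ : Fin j => 1) i0 C)) :
    ∃ y ∈ C, 2 ^ (n + k - 1) + r ≤ y := by
  rw [odd_congr (Zc_red1 (κ := Fin r) (by simp) hr hj i0 C)] at h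
  obtain ⟨π, h1, h2⟩ := Zc_pos _ _ _ h
  obtain ⟨k, rfl⟩ : ∃ k', k = k' + 1 := ⟨k - 1, by omega⟩
  refine ⟨tot (ow (2 ^ n) fun _ : Fin r => 1) π (Fin.last k), ?_, ?_⟩
  · rw [← h2, mem_vals]; exact ⟨_, rfl⟩
  · unfold tot
    rw [Fintype.sum_option, h1]
    have : r ≤ ∑ i : Fin r, 1 * 2 ^ ((π (some i) (Fin.last k) : Fin (k + 1)) : ℕ) := by
      calc r = ∑ i : Fin r, 1 := by simp
        _ ≤ _ := Finset.sum_le_sum (fun i _ => by rw [one_mul]; exact Nat.one_le_two_pow)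
    simp only [ow, Option.elim]
    simp only [Equiv.Perm.one_apply, Fin.val_last]
    rw [← pow_add]
    have h3 : n + (k + 1) - 1 = n + k := by omega
    rw [h3]
    omega

def extP {k : ℕ} (π : Equiv.Perm (Fin k)) : Equiv.Perm (Fin (k + 1)) :=
  (finSuccEquivLast.trans (Equiv.optionCongr π)).trans (finSuccEquiv k).symm

theorem extP_last {k : ℕ} (π : Equiv.Perm (Fin k)) : extP π (Fin.last k) = 0 := by
  simp [extP]

theorem extP_castSucc {k : ℕ} (π : Equiv.Perm (Fin k)) (t : Fin k) :
    extP π t.castSucc = (π t).succ := by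
  simp [extP]

theorem extP_inj {k : ℕ} {π π' : Equiv.Perm (Fin k)} (h : extP π = extP π') : π = π' := by
  ext t
  have := congrArg (fun q => q t.castSucc) h
  simp only [extP_castSucc] at this
  rw [Fin.succ_inj] at this
  rw [this]

theorem extP_surj {k : ℕ} (π : Equiv.Perm (Fin (k + 1))) (h : π (Fin.last k) = 0) :
    ∃ π', extP π' = π := by
  have hne : ∀ t : Fin k, π t.castSucc ≠ 0 := by
    intro t ht
    rw [← h] at ht
    exact (Fin.castSucc_lt_last t).ne (π.injective ht)
  let f : Fin k → Fin k := fun t => (π t.castSucc).pred (hne t)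
  have hf : Function.Injective f := by
    intro s t hst
    simp only [f] at hst
    rw [Fin.pred_inj] at hst
    exact Fin.castSucc_injective _ (π.injective hst)
  refine ⟨Equiv.ofBijective f (Finite.injective_iff_bijective.mp hf), ?_⟩
  apply Equiv.ext
  intro t
  induction t using Fin.lastCases with
  | last => rw [extP_last, h]
  | cast t => rw [extP_castSucc]; simp [f]

theorem vals_succ {k : ℕ} (f : Fin (k + 1) → ℕ) :
    vals f = f (Fin.last k) ::ₘ vals (fun t : Fin k => f t.castSucc) := by
  unfold vals
  rw [Fin.univ_castSuccEmb]
  simp only [Finset.cons_val, Multiset.map_cons, Finset.map_val, Multiset.map_map]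
  rfl

theorem Zc_rec {k n r : ℕ} (C : Multiset ℕ) (hC : ∀ y ∈ C, y < 2 ^ (n + k) + r) :
    Zc (k + 1) (ow (2 ^ n) (fun _ : Fin r => 1)) none ((2 ^ (n + k) + r) ::ₘ C) =
      Zc k (ow (2 ^ n) (fun _ : Fin r => 2)) none C := by
  symm
  let F : (Option (Fin r) → Equiv.Perm (Fin k)) → Option (Fin r) → Equiv.Perm (Fin (k + 1)) :=
    fun π o => o.elim 1 (fun i => extP (π (some i)))
  have hF1 : ∀ π, tot (ow (2 ^ n) fun _ : Fin r => 1) (F π) (Fin.last k) = 2 ^ (n + k) + r := by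
    intro π
    simp [tot, Fintype.sum_option, F, ow, extP_last, pow_add]
  have hF2 : ∀ π : Option (Fin r) → Equiv.Perm (Fin k), π none = 1 →
      (fun t : Fin k => tot (ow (2 ^ n) fun _ : Fin r => 1) (F π) t.castSucc) =
      tot (ow (2 ^ n) fun _ : Fin r => 2) π := by
    intro π h
    funext t
    simp [tot, Fintype.sum_option, F, ow, extP_castSucc, h, pow_succ, mul_comm]
  apply Nat.card_eq_of_bijective
    (fun π : ZZ k (ow (2 ^ n) (fun _ : Fin r => 2)) none C => (⟨F π.1, rfl, by
      rw [vals_succ, hF1, hF2 _ π.2.1, π.2.2]⟩ :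
      ZZ (k + 1) (ow (2 ^ n) (fun _ : Fin r => 1)) none ((2 ^ (n + k) + r) ::ₘ C)))
  constructor
  · intro π π' h
    apply Subtype.ext
    funext o
    have h' := fun o => congrArg (fun q => q.1 o) h
    cases o with
    | none => rw [π.2.1, π'.2.1]
    | some i => exact extP_inj (h' (some i))
  · rintro ⟨π, h1, h2⟩
    have hlast : tot (ow (2 ^ n) fun _ : Fin r => 1) π (Fin.last k) =
        2 ^ (n + k) + ∑ i : Fin r, 2 ^ ((π (some i) (Fin.last k) : Fin (k + 1)) : ℕ) := by
      simp [tot, Fintype.sum_option, ow, h1, pow_add]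
    have hge : ∑ i : Fin r, 1 ≤
        ∑ i : Fin r, 2 ^ ((π (some i) (Fin.last k) : Fin (k + 1)) : ℕ) :=
      Finset.sum_le_sum (fun i _ => Nat.one_le_two_pow)
    have hm : tot (ow (2 ^ n) fun _ : Fin r => 1) π (Fin.last k) ∈ (2 ^ (n + k) + r) ::ₘ C := by
      rw [← h2, mem_vals]; exact ⟨_, rfl⟩
    have hr : ∑ i : Fin r, 1 = r := by simp
    have heq : ∑ i : Fin r, 1 =
        ∑ i : Fin r, 2 ^ ((π (some i) (Fin.last k) : Fin (k + 1)) : ℕ) := by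
      rw [Multiset.mem_cons] at hm
      rcases hm with hm | hm
      · omega
      · have := hC _ hm
        omega
    have hlast' : tot (ow (2 ^ n) fun _ : Fin r => 1) π (Fin.last k) = 2 ^ (n + k) + r := by
      rw [hlast, ← heq, hr]
    rw [Finset.sum_eq_sum_iff_of_le (fun i _ => Nat.one_le_two_pow)] at heq
    have h0 : ∀ i, π (some i) (Fin.last k) = 0 := by
      intro i
      have := heq i (Finset.mem_univ _)
      have h3 : ((π (some i) (Fin.last k) : Fin (k + 1)) : ℕ) = 0 := by
        by_contra hne
        have := Nat.one_lt_two_pow hne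
        omega
      exact Fin.ext h3
    choose ψ hψ using fun i => extP_surj (π (some i)) (h0 i)
    have hFπ : F (fun o => o.elim 1 ψ) = π := by
      funext o
      cases o with
      | none => exact h1.symm
      | some i => exact hψ i
    refine ⟨⟨fun o => o.elim 1 ψ, rfl, ?_⟩, ?_⟩
    · rw [← hF2 _ rfl, hFπ]
      rw [vals_succ, hlast'] at h2
      exact (Multiset.cons_inj_right _).mp h2
    · apply Subtype.ext
      exact hFπ

theorem two_pow_add {a b s : ℕ} (h : 2 ^ a + 2 ^ b = 2 ^ (s + 1)) : a = s ∧ b = s := by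
  have hp : ∀ x : ℕ, 0 < 2 ^ x := fun x => by positivity
  have key : ∀ a b : ℕ, a ≤ b → 2 ^ a + 2 ^ b = 2 ^ (s + 1) → a = s ∧ b = s := by
    intro a b hab h
    have h1 : b < s + 1 := by
      rw [← Nat.pow_lt_pow_iff_right (a := 2) (by norm_num)]
      have := hp a; omega
    have h2 : s ≤ b := by
      by_contra hlt
      have h3 : 2 ^ (b + 1) ≤ 2 ^ s := Nat.pow_le_pow_right (by norm_num) (by omega)
      have h4 : 2 ^ a ≤ 2 ^ b := Nat.pow_le_pow_right (by norm_num) hab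
      have := hp s
      rw [pow_succ] at h3 h; omega
    have h3 : b = s := by omega
    subst h3
    rw [pow_succ] at h
    have : 2 ^ a = 2 ^ b := by omega
    exact ⟨Nat.pow_right_injective (le_refl 2) this, rfl⟩
  rcases le_total a b with hab | hab
  · exact key a b hab h
  · exact (key b a hab (by omega)).symm

theorem Zc_two {k n : ℕ} : ∃ C : Multiset ℕ, (∀ y ∈ C, y ≤ 2 ^ (n + k) + 2 ^ n) ∧
    Zc (k + 1) (ow (2 ^ n) (fun _ : Unit => 2 ^ n)) none C = 1 := by
  let π₀ : Option Unit → Equiv.Perm (Fin (k + 1)) :=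
    fun o => o.elim 1 (fun _ => Equiv.swap 0 (Fin.last k))
  have htot : ∀ π : Option Unit → Equiv.Perm (Fin (k + 1)), π none = 1 → ∀ t,
      tot (ow (2 ^ n) (fun _ : Unit => 2 ^ n)) π t =
        2 ^ n * (2 ^ (t : ℕ) + 2 ^ ((π (some ()) t : Fin (k + 1)) : ℕ)) := by
    intro π h t
    simp [tot, Fintype.sum_option, ow, h, mul_add]
  refine ⟨vals (tot (ow (2 ^ n) (fun _ : Unit => 2 ^ n)) π₀), ?_, ?_⟩
  · intro y hy
    rw [mem_vals] at hy
    obtain ⟨t, rfl⟩ := hy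
    rw [htot _ rfl, pow_add, show 2 ^ n * 2 ^ k + 2 ^ n = 2 ^ n * (2 ^ k + 1) by ring]
    apply Nat.mul_le_mul_left
    simp only [π₀, Option.elim]
    by_cases h0 : t = 0
    · subst h0; simp [add_comm]
    by_cases h1 : t = Fin.last k
    · subst h1; simp
    rw [Equiv.swap_apply_of_ne_of_ne h0 h1]
    have hlt : (t : ℕ) < k := Fin.val_lt_last h1
    have : 2 ^ ((t : ℕ) + 1) ≤ 2 ^ k := Nat.pow_le_pow_right (by norm_num) (by omega)
    rw [pow_succ] at this
    omega
  · have hp : 0 < 2 ^ n := by positivity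
    have : ∀ π : ZZ (k + 1) (ow (2 ^ n) (fun _ : Unit => 2 ^ n)) none
        (vals (tot (ow (2 ^ n) (fun _ : Unit => 2 ^ n)) π₀)), π = ⟨π₀, rfl, rfl⟩ := by
      rintro ⟨π, h1, h2⟩
      apply Subtype.ext
      set ρ := π (some ()) with hρ
      have hmem : ∀ t : Fin (k + 1), ∃ s : Fin (k + 1), 2 ^ (s : ℕ) + 2 ^ ((ρ s : Fin (k + 1)) : ℕ) =
          2 ^ (t : ℕ) + 2 ^ ((Equiv.swap 0 (Fin.last k) t : Fin (k + 1)) : ℕ) := by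
        intro t
        have hm : tot (ow (2 ^ n) (fun _ : Unit => 2 ^ n)) π₀ t ∈
            vals (tot (ow (2 ^ n) (fun _ : Unit => 2 ^ n)) π) := by
          rw [h2, mem_vals]; exact ⟨t, rfl⟩
        rw [mem_vals] at hm
        obtain ⟨s, hs⟩ := hm
        rw [htot _ h1, htot _ rfl] at hs
        exact ⟨s, Nat.eq_of_mul_eq_mul_left hp hs⟩
      have hmid : ∀ t, t ≠ 0 → t ≠ Fin.last k → ρ t = t := by
        intro t h0 hl
        obtain ⟨s, hs⟩ := hmem t
        rw [Equiv.swap_apply_of_ne_of_ne h0 hl] at hs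
        have h3 : (2 : ℕ) ^ (t : ℕ) + 2 ^ (t : ℕ) = 2 ^ ((t : ℕ) + 1) := by rw [pow_succ]; ring
        rw [h3] at hs
        obtain ⟨ha, hb⟩ := two_pow_add hs
        have hst : s = t := Fin.ext ha
        rw [hst] at hb
        exact Fin.ext hb
      have hsw : ρ = Equiv.swap 0 (Fin.last k) := by
        by_cases hk : k = 0
        · subst hk
          ext t; omega
        have h0l : (0 : Fin (k + 1)) ≠ Fin.last k := by
          intro h
          have := congrArg Fin.val h
          simp at this; omega
        have hr0 : ρ 0 ≠ 0 := by
          intro hr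
          have hm : tot (ow (2 ^ n) (fun _ : Unit => 2 ^ n)) π 0 ∈
              vals (tot (ow (2 ^ n) (fun _ : Unit => 2 ^ n)) π₀) := by
            rw [← h2, mem_vals]; exact ⟨0, rfl⟩
          rw [mem_vals] at hm
          obtain ⟨s, hs⟩ := hm
          rw [htot _ h1, htot _ rfl] at hs
          have hs := Nat.eq_of_mul_eq_mul_left hp hs
          rw [← hρ, hr] at hs
          have h3 : (2 : ℕ) ^ ((0 : Fin (k + 1)) : ℕ) + 2 ^ ((0 : Fin (k + 1)) : ℕ) = 2 ^ (0 + 1) := by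
            simp
          rw [h3] at hs
          obtain ⟨ha, hb⟩ := two_pow_add hs
          have hs0 : s = 0 := Fin.ext ha
          rw [hs0] at hb
          simp [π₀] at hb
          omega
        have hrl : ρ 0 = Fin.last k := by
          by_contra hne
          exact hr0 (ρ.injective (hmid _ hr0 hne))
        have hl0 : ρ (Fin.last k) = 0 := by
          by_contra hne
          have hne2 : ρ (Fin.last k) ≠ Fin.last k := by
            intro h
            exact h0l (ρ.injective (hrl.trans h.symm))
          exact hne2 (ρ.injective (hmid _ hne hne2))
        apply Equiv.ext
        intro t
        by_cases h0 : t = 0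
        · rw [h0, hrl, Equiv.swap_apply_left]
        by_cases hl : t = Fin.last k
        · rw [hl, hl0, Equiv.swap_apply_right]
        · rw [hmid t h0 hl, Equiv.swap_apply_of_ne_of_ne h0 hl]
      funext o
      cases o with
      | none => exact h1
      | some u => exact hsw
    unfold Zc
    rw [Nat.card_eq_one_iff_unique]
    exact ⟨⟨fun a b => by rw [this a, this b]⟩, ⟨⟨π₀, rfl, rfl⟩⟩⟩

theorem Zc_upper (k : ℕ) : ∀ n r j : ℕ, 1 ≤ r → r ≤ 2 ^ n → j = 2 ^ n + r → ∀ i0 : Fin j,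
    ∃ C : Multiset ℕ, (∀ y ∈ C, 2 * y ≤ 2 ^ (n + k) + 2 * r) ∧
      Odd (Zc k (fun _ : Fin j => 1) i0 C) := by
  induction k with
  | zero =>
    intro n r j _ _ _ i0
    refine ⟨0, by simp, ?_⟩
    have : Zc 0 (fun _ : Fin j => 1) i0 0 = 1 := by
      unfold Zc
      rw [Nat.card_eq_one_iff_unique]
      refine ⟨⟨fun a b => ?_⟩, ⟨⟨fun _ => 1, rfl, ?_⟩⟩⟩
      · apply Subtype.ext
        funext i
        ext t
        exact t.elim0
      · simp [vals]
    rw [this]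
    exact odd_one
  | succ k ih =>
    intro n r j hr1 hr2 hj i0
    rcases Nat.lt_or_eq_of_le hr2 with hlt | heq
    · have hj' : 0 < 2 ^ n + 2 * r := by omega
      have hpk : 2 ^ n ≤ 2 ^ (n + k) := Nat.pow_le_pow_right (by norm_num) (by omega)
      have main : ∃ C : Multiset ℕ, (∀ y ∈ C, y < 2 ^ (n + k) + r) ∧
          Odd (Zc k (fun _ : Fin (2 ^ n + 2 * r) => 1) ⟨0, hj'⟩ C) := by
        rcases Nat.eq_zero_or_pos k with hk | hk
        · subst hk
          rcases le_or_gt (2 * r) (2 ^ n) with h | h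
          · obtain ⟨C, hC, hodd⟩ := ih n (2 * r) _ (by omega) h rfl ⟨0, hj'⟩
            refine ⟨C, ?_, hodd⟩
            obtain ⟨π, _, h2⟩ := Zc_pos _ _ _ hodd
            intro y hy
            rw [← h2, mem_vals] at hy
            obtain ⟨t, _⟩ := hy
            exact t.elim0
          · obtain ⟨C, hC, hodd⟩ := ih (n + 1) (2 * r - 2 ^ n) (2 ^ n + 2 * r) (by omega)
              (by rw [pow_succ]; omega) (by rw [pow_succ]; omega) ⟨0, hj'⟩
            refine ⟨C, ?_, hodd⟩
            obtain ⟨π, _, h2⟩ := Zc_pos _ _ _ hodd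
            intro y hy
            rw [← h2, mem_vals] at hy
            obtain ⟨t, _⟩ := hy
            exact t.elim0
        · rcases le_or_gt (2 * r) (2 ^ n) with h | h
          · obtain ⟨C, hC, hodd⟩ := ih n (2 * r) _ (by omega) h rfl ⟨0, hj'⟩
            refine ⟨C, ?_, hodd⟩
            intro y hy
            have := hC y hy
            have h5 : 2 ^ (n + 1) ≤ 2 ^ (n + k) := Nat.pow_le_pow_right (by norm_num) (by omega)
            rw [pow_succ] at h5
            omega
          · obtain ⟨C, hC, hodd⟩ := ih (n + 1) (2 * r - 2 ^ n) (2 ^ n + 2 * r) (by omega)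
              (by rw [pow_succ]; omega) (by rw [pow_succ]; omega) ⟨0, hj'⟩
            refine ⟨C, ?_, hodd⟩
            intro y hy
            have := hC y hy
            rw [show n + 1 + k = (n + k) + 1 by ring, pow_succ] at this
            omega
      obtain ⟨C, hC, hodd⟩ := main
      refine ⟨(2 ^ (n + k) + r) ::ₘ C, ?_, ?_⟩
      · intro y hy
        rw [← add_assoc, pow_succ]
        rw [Multiset.mem_cons] at hy
        rcases hy with rfl | hy
        · omega
        · have := hC y hy; omega
      · rw [odd_congr (Zc_red1 (κ := Fin r) (by simp) hr1 hj i0 _), Zc_rec C hC,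
          ← odd_congr (Zc_red2 hr1 rfl ⟨0, hj'⟩ C)]
        exact hodd
    · subst heq
      obtain ⟨C, hC, h1⟩ := Zc_two (k := k) (n := n)
      refine ⟨C, ?_, ?_⟩
      · intro y hy
        have := hC y hy
        rw [← add_assoc, pow_succ]
        omega
      · rw [odd_congr (Zc_red3 hj i0 C), h1]
        exact odd_one

section Lists
variable {α : Type} [DecidableEq α]

def NE (L : List α) : Prop := ∀ w, w <:+: L → w ≠ [] → ∃ t, Odd (w.count t)

theorem NE.of_infix {L L' : List α} (h : NE L) (h' : L' <:+: L) : NE L' :=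
  fun w hw hn => h w (hw.trans h') hn

theorem NE.reverse {L : List α} (h : NE L) : NE L.reverse := by
  intro w hw hn
  have h1 : w.reverse <:+: L := by
    rw [← List.reverse_infix, List.reverse_reverse]; exact hw
  obtain ⟨t, ht⟩ := h _ h1 (by simpa using hn)
  exact ⟨t, by simpa using ht⟩

theorem NE.map {L : List α} (h : NE L) (σ : Equiv.Perm α) : NE (L.map σ) := by
  intro w hw hn
  have h1 : w.map σ.symm <:+: L := by
    have := hw.map σ.symm
    simpa using this
  obtain ⟨t, ht⟩ := h _ h1 (by simpa using hn)
  refine ⟨σ t, ?_⟩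
  have h2 := List.count_map_of_injective w σ.symm σ.symm.injective (σ t)
  rw [Equiv.symm_apply_apply] at h2
  rwa [← h2]

theorem NE.mid {w v : List α} {m : α} (hw : NE w) (hv : NE v) (h1 : m ∉ w) (h2 : m ∉ v) :
    NE (w ++ m :: v) := by
  intro u hu hn
  by_cases hm : m ∈ u
  · refine ⟨m, ?_⟩
    have hle : u.count m ≤ (w ++ m :: v).count m := hu.sublist.count_le m
    have h3 : (w ++ m :: v).count m = 1 := by
      simp [List.count_eq_zero_of_not_mem h1, List.count_eq_zero_of_not_mem h2]
    have h4 : 0 < u.count m := List.count_pos_iff.mpr hm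
    have : u.count m = 1 := by omega
    rw [this]; exact odd_one
  · obtain ⟨x, y, hxy⟩ := hu
    rw [List.append_assoc, List.append_eq_append_iff] at hxy
    rcases hxy with ⟨a, ha, hb⟩ | ⟨c, hc, hd⟩
    · rw [List.append_eq_append_iff] at hb
      rcases hb with ⟨a', ha', hb'⟩ | ⟨c, hc, hd⟩
      · exact hw u ⟨x, a', by rw [ha, ha', List.append_assoc]⟩ hn
      · cases c with
        | nil =>
          simp at hc
          exact hw u ⟨x, [], by rw [ha, hc]; simp⟩ hn
        | cons b c =>
          simp at hd
          exact absurd (by rw [hc, hd.1]; simp) hm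
    · cases c with
      | nil =>
        cases u with
        | nil => exact absurd rfl hn
        | cons b u =>
          simp at hd
          exact absurd (by rw [hd.1]; simp) hm
      | cons b c =>
        simp at hd
        exact hv u ⟨c, y, by rw [hd.2]; simp⟩ hn

theorem NE.pal {w : List α} {m : α} (h : NE (w ++ m :: w.reverse)) : m ∉ w := by
  intro hm
  obtain ⟨u, v, rfl⟩ := List.append_of_mem hm
  obtain ⟨t, ht⟩ := h (m :: v ++ m :: v.reverse) ⟨u, m :: u.reverse, by simp⟩ (by simp)
  rw [Nat.odd_iff] at ht
  simp only [List.count_append, List.count_cons, List.count_reverse] at ht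
  omega

theorem exists_pal {L : List α} {l : ℕ} (h : L.reverse = L) (hl : L.length = 2 * l + 1) :
    ∃ w m, L = w ++ m :: w.reverse ∧ w.length = l := by
  have h1 : L = L.take l ++ L.drop l := (List.take_append_drop l L).symm
  have hd : (L.drop l).length = l + 1 := by simp; omega
  have ht : (L.take l).length = l := by simp; omega
  obtain ⟨m, v, hmv⟩ : ∃ m v, L.drop l = m :: v := by
    cases hq : L.drop l with
    | nil => rw [hq] at hd; simp at hd
    | cons m v => exact ⟨m, v, rfl⟩
  refine ⟨L.take l, m, ?_, ht⟩
  have hv : v.length = l := by rw [hmv] at hd; simpa using hd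
  have h2 : L = L.take l ++ m :: v := by rw [← hmv]; exact h1
  have h3 : L.reverse = v.reverse ++ m :: (L.take l).reverse := by
    conv_lhs => rw [h2]
    simp
  rw [h] at h3
  have h4 := List.append_inj (h2.symm.trans h3) (by rw [ht]; simp [hv])
  rw [← h4.2]
  exact h2

def ff : ℕ → List α → List α
  | 0, L => L
  | k + 1, L => if L.reverse = L then
      ff k (L.take (2 ^ k - 1)) ++ ((L.drop (2 ^ k - 1)).take 1 ++
        (ff k (L.take (2 ^ k - 1))).reverse)
    else L.reverse

theorem ff_pal (k : ℕ) (w : List α) (m : α) (h : w.length = 2 ^ k - 1) :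
    ff (k + 1) (w ++ m :: w.reverse) = ff k w ++ m :: (ff k w).reverse := by
  have h1 : (w ++ m :: w.reverse).reverse = w ++ m :: w.reverse := by simp
  rw [ff, if_pos h1]
  have h2 : (w ++ m :: w.reverse).take (2 ^ k - 1) = w := by
    rw [← h]; simp
  have h3 : (w ++ m :: w.reverse).drop (2 ^ k - 1) = m :: w.reverse := by
    rw [← h]; simp
  rw [h2, h3]
  simp

theorem ff_npal (k : ℕ) (L : List α) (h : L.reverse ≠ L) : ff (k + 1) L = L.reverse := by
  rw [ff, if_neg h]

theorem pow_len (k : ℕ) : 2 ^ (k + 1) - 1 = 2 * (2 ^ k - 1) + 1 := by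
  have : 0 < 2 ^ k := by positivity
  rw [pow_succ]; omega

theorem ff_perm (k : ℕ) : ∀ L : List α, L.length = 2 ^ k - 1 → (ff k L).Perm L := by
  induction k with
  | zero => intro L _; exact List.Perm.refl _
  | succ k ih =>
    intro L hL
    by_cases h : L.reverse = L
    · obtain ⟨w, m, rfl, hw⟩ := exists_pal h (hL.trans (pow_len k))
      rw [ff_pal k w m hw]
      have := ih w hw
      exact this.append (List.Perm.cons m (((List.reverse_perm _).trans this).trans
        (List.reverse_perm _).symm))
    · rw [ff_npal k L h]; exact List.reverse_perm L

theorem ff_len (k : ℕ) (L : List α) (h : L.length = 2 ^ k - 1) : (ff k L).length = 2 ^ k - 1 := by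
  rw [(ff_perm k L h).length_eq, h]

theorem ff_ff (k : ℕ) : ∀ L : List α, L.length = 2 ^ k - 1 → ff k (ff k L) = L := by
  induction k with
  | zero => intro L _; rfl
  | succ k ih =>
    intro L hL
    by_cases h : L.reverse = L
    · obtain ⟨w, m, rfl, hw⟩ := exists_pal h (hL.trans (pow_len k))
      rw [ff_pal k w m hw, ff_pal k _ m (ff_len k w hw), ih w hw]
    · rw [ff_npal k L h, ff_npal k, List.reverse_reverse]
      rw [List.reverse_reverse]
      exact fun h' => h h'.symm

theorem ff_NE (k : ℕ) : ∀ L : List α, L.length = 2 ^ k - 1 → NE L → NE (ff k L) := by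
  induction k with
  | zero => intro L _ h; exact h
  | succ k ih =>
    intro L hL hN
    by_cases h : L.reverse = L
    · obtain ⟨w, m, rfl, hw⟩ := exists_pal h (hL.trans (pow_len k))
      rw [ff_pal k w m hw]
      have h1 := ih w hw (hN.of_infix ⟨[], m :: w.reverse, by simp⟩)
      have h2 : m ∉ ff k w := by rw [(ff_perm k w hw).mem_iff]; exact hN.pal
      exact h1.mid h1.reverse h2 (by simpa using h2)
    · rw [ff_npal k L h]; exact hN.reverse

theorem ff_map (k : ℕ) (σ : Equiv.Perm α) : ∀ L : List α, L.length = 2 ^ k - 1 →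
    ff k (L.map σ) = (ff k L).map σ := by
  induction k with
  | zero => intro L _; rfl
  | succ k ih =>
    intro L hL
    by_cases h : L.reverse = L
    · obtain ⟨w, m, rfl, hw⟩ := exists_pal h (hL.trans (pow_len k))
      rw [ff_pal k w m hw]
      have h1 : (w ++ m :: w.reverse).map σ = w.map σ ++ σ m :: (w.map σ).reverse := by simp
      rw [h1, ff_pal k _ _ (by simpa using hw), ih w hw]
      simp
    · rw [ff_npal k L h, ff_npal, List.map_reverse]
      rw [← List.map_reverse]
      intro h'
      exact h (List.map_injective_iff.mpr σ.injective h')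

def stdL : (k : ℕ) → (Fin k → α) → List α
  | 0, _ => []
  | k + 1, a => stdL k (fun i => a i.succ) ++ a 0 :: stdL k (fun i => a i.succ)

theorem stdL_rev (k : ℕ) (a : Fin k → α) : (stdL k a).reverse = stdL k a := by
  induction k with
  | zero => rfl
  | succ k ih => simp [stdL, ih]

theorem stdL_len (k : ℕ) (a : Fin k → α) : (stdL k a).length = 2 ^ k - 1 := by
  induction k with
  | zero => rfl
  | succ k ih => rw [pow_len]; simp [stdL, ih]; omega

theorem stdL_ff (k : ℕ) (a : Fin k → α) : ff k (stdL k a) = stdL k a := by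
  induction k with
  | zero => rfl
  | succ k ih =>
    have : stdL (k + 1) a = stdL k (fun i => a i.succ) ++ a 0 ::
        (stdL k (fun i => a i.succ)).reverse := by rw [stdL_rev]; rfl
    rw [this, ff_pal k _ _ (stdL_len k _), ih]

theorem stdL_mem (k : ℕ) (a : Fin k → α) (x : α) : x ∈ stdL k a ↔ ∃ i, a i = x := by
  induction k with
  | zero => simp [stdL]
  | succ k ih =>
    simp only [stdL, List.mem_append, List.mem_cons, ih, Fin.exists_fin_succ]
    constructor
    · rintro (h | h | h)
      · exact Or.inr h
      · exact Or.inl h.symm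
      · exact Or.inr h
    · rintro (h | h)
      · exact Or.inr (Or.inl h.symm)
      · exact Or.inl h

theorem stdL_NE (k : ℕ) (a : Fin k → α) (ha : Function.Injective a) : NE (stdL k a) := by
  induction k with
  | zero =>
    intro w hw hn
    simp [stdL] at hw
    exact absurd hw hn
  | succ k ih =>
    have h1 := ih (fun i => a i.succ) (ha.comp (Fin.succ_injective _))
    have h2 : a 0 ∉ stdL k (fun i => a i.succ) := by
      rw [stdL_mem]
      rintro ⟨i, hi⟩
      exact Fin.succ_ne_zero i (ha hi)
    exact h1.mid h1 h2 h2

theorem stdL_count (k : ℕ) (a : Fin k → α) (ha : Function.Injective a) (i : Fin k) :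
    (stdL k a).count (a i) = 2 ^ (i : ℕ) := by
  induction k with
  | zero => exact i.elim0
  | succ k ih =>
    have h2 : a 0 ∉ stdL k (fun i => a i.succ) := by
      rw [stdL_mem]
      rintro ⟨i, hi⟩
      exact Fin.succ_ne_zero i (ha hi)
    induction i using Fin.cases with
    | zero => simp [stdL, List.count_eq_zero_of_not_mem h2]
    | succ i =>
      have h1 := ih (fun i => a i.succ) (ha.comp (Fin.succ_injective _)) i
      have h3 : a 0 ≠ a i.succ := fun h => Fin.succ_ne_zero i (ha h).symm
      simp only [stdL, List.count_append, List.count_cons_of_ne h3, h1]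
      simp [pow_succ]; ring

theorem stdL_map (k : ℕ) (a : Fin k → α) (σ : Equiv.Perm α) :
    (stdL k a).map σ = stdL k (fun i => σ (a i)) := by
  induction k with
  | zero => rfl
  | succ k ih => simp [stdL, ih]

theorem stdL_inj (k : ℕ) (a b : Fin k → α) (h : stdL k a = stdL k b) : a = b := by
  induction k with
  | zero => funext i; exact i.elim0
  | succ k ih =>
    have h1 := List.append_inj h (by rw [stdL_len, stdL_len])
    have h2 := ih _ _ h1.1
    have h3 := (List.cons.inj h1.2).1
    funext i
    induction i using Fin.cases with
    | zero => exact h3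
    | succ i => exact congrFun h2 i

theorem ff_fixed (k : ℕ) : ∀ L : List α, L.length = 2 ^ k - 1 → NE L → ff k L = L →
    ∃ a : Fin k → α, Function.Injective a ∧ L = stdL k a := by
  induction k with
  | zero =>
    intro L hL _ _
    refine ⟨fun i => i.elim0, fun i => i.elim0, ?_⟩
    simpa [stdL] using hL
  | succ k ih =>
    intro L hL hN hf
    have h : L.reverse = L := by
      by_contra h
      rw [ff_npal k L h] at hf
      exact h hf
    obtain ⟨w, m, rfl, hw⟩ := exists_pal h (hL.trans (pow_len k))
    rw [ff_pal k w m hw] at hf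
    have h1 := (List.append_inj hf (by rw [ff_len k w hw, hw])).1
    obtain ⟨a, ha, hwa⟩ := ih w hw (hN.of_infix ⟨[], m :: w.reverse, by simp⟩) h1
    have hm := hN.pal
    refine ⟨Fin.cons m a, ?_, ?_⟩
    · rw [Fin.cons_injective_iff]
      refine ⟨?_, ha⟩
      rw [hwa, stdL_mem] at hm
      exact hm
    · rw [hwa, stdL_rev]
      rfl

end Lists

section Orbits
variable {j k : ℕ}

def actS (σ : Equiv.Perm (Fin k)) (x : Fin j → List (Fin k)) : Fin j → List (Fin k) :=
  fun i => (x i).map σ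

theorem actS_one (x : Fin j → List (Fin k)) : actS 1 x = x := by
  funext i; simp [actS]

theorem actS_mul (σ τ : Equiv.Perm (Fin k)) (x : Fin j → List (Fin k)) :
    actS (σ * τ) x = actS σ (actS τ x) := by
  funext i; simp [actS]

def orbS (j k : ℕ) : Setoid (Fin j → List (Fin k)) where
  r x y := ∃ σ : Equiv.Perm (Fin k), y = actS σ x
  iseqv := by
    refine ⟨fun x => ⟨1, (actS_one x).symm⟩, ?_, ?_⟩
    · rintro x y ⟨σ, rfl⟩
      exact ⟨σ⁻¹, by rw [← actS_mul]; simp [actS_one]⟩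
    · rintro x y z ⟨σ, rfl⟩ ⟨τ, rfl⟩
      exact ⟨τ * σ, by rw [actS_mul]⟩

def cls (x : Fin j → List (Fin k)) : Quotient (orbS j k) := Quotient.mk _ x

theorem cls_eq {x y : Fin j → List (Fin k)} : cls x = cls y ↔ ∃ σ, y = actS σ x :=
  Quotient.eq (r := orbS j k)

noncomputable def cnt (P : (Fin j → List (Fin k)) → Prop) : ℕ := Nat.card (cls '' {x | P x})

theorem cnt_inv (P : (Fin j → List (Fin k)) → Prop) (φ : (Fin j → List (Fin k)) → Fin j → List (Fin k))
    (hfin : {x | P x}.Finite) (hσ : ∀ σ x, P x → P (actS σ x)) (hφ : ∀ x, P x → P (φ x))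
    (hφφ : ∀ x, P x → φ (φ x) = x) (hc : ∀ σ x, P x → φ (actS σ x) = actS σ (φ x))
    (hfree : ∀ σ x, P x → φ x = actS σ x → φ x = x) :
    cnt P ≡ cnt (fun x => P x ∧ φ x = x) [MOD 2] := by
  classical
  unfold cnt
  have hf : Finite (cls '' {x | P x}) := (hfin.image _).to_subtype
  have hrep : ∀ q : (cls '' {x | P x}), ∃ x, P x ∧ cls x = q.1 := fun q => q.2
  choose rep hrP hrq using hrep
  let ψ : (cls '' {x | P x}) → (cls '' {x | P x}) := fun q =>
    ⟨cls (φ (rep q)), φ (rep q), hφ _ (hrP q), rfl⟩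
  have hψ : ∀ x (hx : P x), ψ ⟨cls x, x, hx, rfl⟩ = ⟨cls (φ x), φ x, hφ x hx, rfl⟩ := by
    intro x hx
    apply Subtype.ext
    have h1 := hrq ⟨cls x, x, hx, rfl⟩
    obtain ⟨σ, h2⟩ := cls_eq.mp h1
    change cls (φ (rep _)) = cls (φ x)
    rw [cls_eq]
    refine ⟨σ, ?_⟩
    rw [← hc _ _ (hrP _), ← h2]
  have h1 := card_fix_end ψ 1 (by
    rintro ⟨_, x, hx, rfl⟩
    change ψ (ψ _) = _
    rw [hψ x hx, hψ _ (hφ x hx)]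
    apply Subtype.ext
    change cls (φ (φ x)) = cls x
    rw [hφφ x hx])
  refine h1.trans ?_
  have : Nat.card {q // ψ q = q} = Nat.card (cls '' {x | P x ∧ φ x = x}) := by
    apply Nat.card_eq_of_bijective
      (fun q : {q // ψ q = q} => (⟨q.1.1, by
        obtain ⟨⟨_, x, hx, rfl⟩, h⟩ := q
        rw [hψ x hx] at h
        have h2 := congrArg Subtype.val h
        obtain ⟨σ, h3⟩ := cls_eq.mp h2.symm
        exact ⟨x, ⟨hx, hfree σ x hx h3⟩, rfl⟩⟩ : (cls '' {x | P x ∧ φ x = x})))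
    constructor
    · intro q q' h
      apply Subtype.ext
      apply Subtype.ext
      have h' := congrArg Subtype.val h
      exact h'
    · rintro ⟨_, x, ⟨hx, hfx⟩, rfl⟩
      refine ⟨⟨⟨cls x, x, hx, rfl⟩, ?_⟩, rfl⟩
      rw [hψ x hx]
      apply Subtype.ext
      change cls (φ x) = cls x
      rw [hfx]
  rw [this]

def gr (L : List (Fin k)) (m : ℕ) (t : Fin k) : Bool := decide (Odd ((L.take m).count t))

theorem gr_zero (L : List (Fin k)) (t : Fin k) : gr L 0 t = false := by
  simp [gr]

theorem gr_succ (L : List (Fin k)) (m : ℕ) (h : m < L.length) (t : Fin k) :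
    gr L (m + 1) t = xor (gr L m t) (decide (L[m] = t)) := by
  unfold gr
  rw [List.take_succ_eq_append_getElem h, List.count_append, List.count_singleton]
  by_cases h1 : L[m] = t
  · simp only [h1, Nat.odd_add_one, decide_true, Bool.xor_true, if_true, beq_self_eq_true]
    rw [decide_not]
  · simp [h1]

theorem gr_map (L : List (Fin k)) (m : ℕ) (σ : Equiv.Perm (Fin k)) (t : Fin k) :
    gr (L.map σ) m t = gr L m (σ.symm t) := by
  unfold gr
  rw [← List.map_take]
  have h2 := List.count_map_of_injective (L.take m) σ σ.injective (σ.symm t)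
  rw [Equiv.apply_symm_apply] at h2
  rw [h2]

def VL (L : List (Fin k)) : Prop := L.length = 2 ^ k - 1 ∧ NE L

theorem gr_ne (L : List (Fin k)) (h : NE L) (a b : ℕ) (hab : a < b) (hb : b ≤ L.length)
    (he : ∀ t, gr L a t = gr L b t) : False := by
  have h1 : L.take b = L.take a ++ (L.take b).drop a := by
    conv_lhs => rw [← List.take_append_drop a (L.take b)]
    rw [List.take_take, min_eq_left hab.le]
  have h2 : (L.take b).drop a <:+: L :=
    (List.drop_suffix _ _).isInfix.trans (List.take_prefix _ _).isInfix
  obtain ⟨t, ht⟩ := h _ h2 (by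
    intro h0
    have := congrArg List.length h0
    simp at this
    omega)
  have h3 := he t
  unfold gr at h3
  rw [h1, List.count_append, decide_eq_decide, Nat.odd_add] at h3
  rw [← Nat.not_even_iff_odd] at ht
  tauto

theorem gr_inj (L : List (Fin k)) (h : VL L) (β : Fin k → Bool) :
    Function.Bijective (fun (m : Fin (2 ^ k)) (t : Fin k) => xor (β t) (gr L m t)) := by
  have hp : 0 < 2 ^ k := by positivity
  have hlen := h.1
  rw [Fintype.bijective_iff_injective_and_card]
  constructor
  · intro a b hab
    have he : ∀ t, gr L a t = gr L b t := by
      intro t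
      have := congrFun hab t
      simpa using this
    apply Fin.ext
    by_contra hne
    rcases Nat.lt_or_gt_of_ne hne with hlt | hlt
    · exact gr_ne L h.2 a b hlt (by omega) he
    · exact gr_ne L h.2 b a hlt (by omega) (fun t => (he t).symm)
  · simp

theorem VL.full {L : List (Fin k)} (h : VL L) (t : Fin k) : t ∈ L := by
  by_contra ht
  obtain ⟨m, hm⟩ := (gr_inj L h (fun _ => false)).2 (fun _ => true)
  have := congrFun hm t
  simp only [gr, Bool.false_xor, decide_eq_true_eq] at this
  have h0 : (L.take m).count t = 0 := List.count_eq_zero_of_not_mem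
    (fun h' => ht (List.mem_of_mem_take h'))
  rw [h0] at this
  simp at this

theorem VL.map {L : List (Fin k)} (h : VL L) (σ : Equiv.Perm (Fin k)) : VL (L.map σ) :=
  ⟨by simpa using h.1, h.2.map σ⟩

theorem VL.eq_one {L : List (Fin k)} (h : VL L) (σ : Equiv.Perm (Fin k)) (hσ : L.map σ = L) :
    σ = 1 := by
  apply Equiv.ext
  intro t
  have ht := h.full t
  have h1 : L.map σ = L.map id := by simpa using hσ
  exact List.map_inj_left.mp h1 t ht

def cts (x : Fin j → List (Fin k)) (t : Fin k) : ℕ := ∑ i, (x i).count t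

theorem cts_act (σ : Equiv.Perm (Fin k)) (x : Fin j → List (Fin k)) (t : Fin k) :
    cts (actS σ x) (σ t) = cts x t := by
  unfold cts actS
  apply Finset.sum_congr rfl
  intro i _
  exact List.count_map_of_injective _ σ σ.injective t

def PP (C : Multiset ℕ) (x : Fin j → List (Fin k)) : Prop := (∀ i, VL (x i)) ∧ vals (cts x) = C

theorem PP_act (C : Multiset ℕ) (σ : Equiv.Perm (Fin k)) (x : Fin j → List (Fin k))
    (h : PP C x) : PP C (actS σ x) := by
  refine ⟨fun i => (h.1 i).map σ, ?_⟩
  rw [← h.2]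
  exact (map_eq_of_perm _ _ σ (cts_act σ x)).symm

theorem PP_fin (C : Multiset ℕ) : {x : Fin j → List (Fin k) | PP C x}.Finite := by
  apply (Set.Finite.pi (fun _ : Fin j => List.finite_length_eq (Fin k) (2 ^ k - 1))).subset
  intro x hx i _
  exact (hx.1 i).1

theorem cnt_std (hj : 2 ≤ j) (C : Multiset ℕ) :
    cnt (j := j) (k := k) (PP C) ≡ cnt (fun x : Fin j → List (Fin k) =>
      PP C x ∧ ∀ i ∈ (Finset.univ : Finset (Fin j)), ff k (x i) = x i) [MOD 2] := by
  classical
  generalize (Finset.univ : Finset (Fin j)) = s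
  induction s using Finset.induction_on with
  | empty => simp; rfl
  | insert a s ha ih =>
    refine ih.trans ?_
    have h1 := cnt_inv (fun x : Fin j → List (Fin k) => PP C x ∧ ∀ i ∈ s, ff k (x i) = x i)
      (fun x => Function.update x a (ff k (x a)))
      ((PP_fin C).subset (fun x hx => hx.1))
      (by
        rintro σ x ⟨h1, h2⟩
        refine ⟨PP_act C σ x h1, fun i hi => ?_⟩
        simp only [actS]
        rw [ff_map k σ _ (h1.1 i).1, h2 i hi])
      (by
        rintro x ⟨⟨h1, h3⟩, h2⟩
        refine ⟨⟨fun i => ?_, ?_⟩, fun i hi => ?_⟩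
        · by_cases hia : i = a
          · subst hia
            simp only [Function.update_self]
            exact ⟨ff_len k _ (h1 i).1, ff_NE k _ (h1 i).1 (h1 i).2⟩
          · rw [Function.update_of_ne hia]; exact h1 i
        · rw [← h3]
          congr 1
          funext t
          unfold cts
          apply Finset.sum_congr rfl
          intro i _
          by_cases hia : i = a
          · subst hia
            simp only [Function.update_self]
            exact (ff_perm k _ (h1 i).1).count_eq t
          · rw [Function.update_of_ne hia]
        · have hia : i ≠ a := fun h => ha (h ▸ hi)
          rw [Function.update_of_ne hia]; exact h2 i hi)
      (by
        rintro x ⟨⟨h1, h3⟩, h2⟩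
        simp only [Function.update_self, Function.update_idem]
        rw [ff_ff k _ (h1 a).1, Function.update_eq_self])
      (by
        rintro σ x ⟨⟨h1, h3⟩, h2⟩
        funext i
        by_cases hia : i = a
        · subst hia
          simp only [Function.update_self, actS]
          exact ff_map k σ _ (h1 i).1
        · simp only [Function.update_of_ne hia, actS])
      (by
        rintro σ x ⟨⟨h1, h3⟩, h2⟩ h
        obtain ⟨i, hi⟩ : ∃ i, i ≠ a := by
          have : Nontrivial (Fin j) := Fin.nontrivial_iff_two_le.mpr hj
          exact exists_ne a
        have h4 := congrFun h i
        rw [Function.update_of_ne hi] at h4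
        have h5 := (h1 i).eq_one σ h4.symm
        rw [h, h5, actS_one])
    refine h1.trans ?_
    have : (fun x : Fin j → List (Fin k) => (PP C x ∧ ∀ i ∈ s, ff k (x i) = x i) ∧
        Function.update x a (ff k (x a)) = x) =
        (fun x => PP C x ∧ ∀ i ∈ insert a s, ff k (x i) = x i) := by
      funext x
      rw [Function.update_eq_self_iff, Finset.forall_mem_insert]
      apply propext
      tauto
    rw [this]

theorem cnt_Z (i0 : Fin j) (C : Multiset ℕ) :
    cnt (fun x : Fin j → List (Fin k) =>
      PP C x ∧ ∀ i ∈ (Finset.univ : Finset (Fin j)), ff k (x i) = x i) =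
    Zc k (fun _ : Fin j => 1) i0 C := by
  symm
  let X : (Fin j → Equiv.Perm (Fin k)) → Fin j → List (Fin k) :=
    fun π i => stdL k (π i).symm
  have hX : ∀ π, cts (X π) = tot (fun _ => 1) π := by
    intro π
    funext t
    unfold cts tot
    apply Finset.sum_congr rfl
    intro i _
    have := stdL_count k (π i).symm (π i).symm.injective (π i t)
    rw [Equiv.symm_apply_apply] at this
    simp only [X, one_mul]
    exact this
  have hact : ∀ σ π, actS σ (X π) = X (fun i => π i * σ⁻¹) := by
    intro σ π
    funext i
    simp only [actS, X]
    rw [stdL_map]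
    rfl
  have hXinj : ∀ π π', X π = X π' → π = π' := by
    intro π π' h
    funext i
    have h1 := stdL_inj k _ _ (congrFun h i)
    have h2 : (π i).symm = (π' i).symm := Equiv.ext (fun t => congrFun h1 t)
    have := congrArg Equiv.symm h2
    simpa using this
  apply Nat.card_eq_of_bijective
    (fun π : ZZ k (fun _ : Fin j => 1) i0 C => (⟨cls (X π.1), X π.1, ⟨⟨fun i =>
      ⟨stdL_len _ _, stdL_NE _ _ (π.1 i).symm.injective⟩, by rw [hX]; exact π.2.2⟩,
      fun i _ => stdL_ff _ _⟩, rfl⟩ : (cls '' {x : Fin j → List (Fin k) |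
      PP C x ∧ ∀ i ∈ (Finset.univ : Finset (Fin j)), ff k (x i) = x i})))
  constructor
  · rintro ⟨π, h1, h2⟩ ⟨π', h1', h2'⟩ h
    apply Subtype.ext
    have h3 := congrArg Subtype.val h
    obtain ⟨σ, h4⟩ := cls_eq.mp h3
    change X π' = actS σ (X π) at h4
    rw [hact] at h4
    have h5 := hXinj _ _ h4
    have h6 := congrFun h5 i0
    rw [h1, h1', one_mul] at h6
    have h7 : σ = 1 := by rw [← inv_inj, ← h6, inv_one]
    rw [h7] at h5
    simpa using h5.symm
  · rintro ⟨_, x, ⟨⟨h1, h2⟩, h3⟩, rfl⟩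
    choose a ha hxa using fun i => ff_fixed k (x i) (h1 i).1 (h1 i).2 (h3 i (Finset.mem_univ i))
    let π : Fin j → Equiv.Perm (Fin k) := fun i =>
      (Equiv.ofBijective (a i) (Finite.injective_iff_bijective.mp (ha i))).symm
    have hx : x = X π := by
      funext i
      rw [hxa i]
      rfl
    refine ⟨⟨fun i => π i * (π i0)⁻¹, by simp, ?_⟩, ?_⟩
    · rw [vals_tot_mul, ← hX, ← hx, h2]
    · apply Subtype.ext
      change cls (X fun i => π i * (π i0)⁻¹) = cls x
      rw [← hact, ← hx]
      symm
      rw [cls_eq]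
      exact ⟨_, rfl⟩

end Orbits

section Matrices
variable {j k : ℕ}

theorem count_ofFn {α : Type} [DecidableEq α] (n : ℕ) (D : Fin n → α) (t : α) :
    (List.ofFn D).count t = (Finset.univ.filter fun i => D i = t).card := by
  rw [Finset.card_filter]
  induction n with
  | zero => simp
  | succ n ih =>
    rw [List.ofFn_succ, List.count_cons, Fin.sum_univ_succ, ih, add_comm]
    simp

/-- `g` has delta list `L` and offset `β`. -/
def GRel (g : Fin (2 ^ k) → Fin k → Bool) (L : List (Fin k)) (β : Fin k → Bool) : Prop :=
  ∀ (m : Fin (2 ^ k)) (t : Fin k), g m t = xor (β t) (gr L m t)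

theorem GRel.step {g : Fin (2 ^ k) → Fin k → Bool} {L : List (Fin k)} {β : Fin k → Bool}
    (h : GRel g L β) (i : Fin (2 ^ k - 1)) (hi : i.val < L.length) (t : Fin k) :
    g (finLo k i) t ≠ g (finHi k i) t ↔ L[i.val] = t := by
  rw [h, h]
  change xor (β t) (gr L i t) ≠ xor (β t) (gr L (i + 1) t) ↔ _
  rw [gr_succ L i hi]
  by_cases h1 : L[i.val] = t <;> simp [h1]

theorem GRel.unique {g : Fin (2 ^ k) → Fin k → Bool} {L L' : List (Fin k)} {β β' : Fin k → Bool}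
    (h : GRel g L β) (h' : GRel g L' β') (hL : L.length = 2 ^ k - 1) (hL' : L'.length = 2 ^ k - 1) :
    L = L' := by
  apply List.ext_getElem (by rw [hL, hL'])
  intro n h1 h2
  have a := h.step ⟨n, by omega⟩ h1 L'[n]
  have b := h'.step ⟨n, by omega⟩ h2 L'[n]
  exact a.mp (b.mpr rfl)

theorem GRel.count {g : Fin (2 ^ k) → Fin k → Bool} {L : List (Fin k)} {β : Fin k → Bool}
    (h : GRel g L β) (hL : L.length = 2 ^ k - 1) (t : Fin k) :
    grayTransCount k g t = L.count t := by
  have h1 : L = List.ofFn (fun i : Fin (2 ^ k - 1) => L[i.val]'(by omega)) := by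
    apply List.ext_getElem (by simp [hL])
    intro n h1 h2
    simp
  conv_rhs => rw [h1]
  rw [count_ofFn]
  unfold grayTransCount
  congr 1
  apply Finset.filter_congr
  intro i _
  exact h.step i (by omega) t

theorem GRel.gray {g : Fin (2 ^ k) → Fin k → Bool} {L : List (Fin k)} {β : Fin k → Bool}
    (h : GRel g L β) (hL : VL L) : IsGrayCode k g := by
  have hg : g = fun (m : Fin (2 ^ k)) (t : Fin k) => xor (β t) (gr L m t) := by
    funext m t; exact h m t
  refine ⟨?_, ?_⟩
  · rw [hg]; exact gr_inj L hL β
  · intro i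
    have hi : i.val < L.length := by rw [hL.1]; exact i.isLt
    refine ⟨L[i.val], (h.step i hi _).mpr rfl, ?_⟩
    intro t ht
    exact ((h.step i hi t).mp ht).symm

theorem gray_GRel {g : Fin (2 ^ k) → Fin k → Bool} (h : IsGrayCode k g) :
    ∃ L β, VL L ∧ GRel g L β := by
  have hp : 0 < 2 ^ k := by positivity
  choose D hD hD' using h.2
  let L := List.ofFn D
  have hlen : L.length = 2 ^ k - 1 := by simp [L]
  have hR : GRel g L (g ⟨0, hp⟩) := by
    have : ∀ (m : ℕ) (hm : m < 2 ^ k) (t : Fin k),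
        g ⟨m, hm⟩ t = xor (g ⟨0, hp⟩ t) (gr L m t) := by
      intro m
      induction m with
      | zero => intro hm t; simp [gr_zero]
      | succ m ih =>
        intro hm t
        have hm' : m < L.length := by omega
        rw [gr_succ L m hm', ← Bool.xor_assoc, ← ih (by omega) t]
        have hLm : L[m] = D ⟨m, by omega⟩ := by simp [L]
        rw [hLm]
        have h1 : g (finLo k ⟨m, by omega⟩) t = g ⟨m, by omega⟩ t := rfl
        have h2 : g (finHi k ⟨m, by omega⟩) t = g ⟨m + 1, hm⟩ t := rfl
        by_cases ht : D ⟨m, by omega⟩ = t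
        · have := hD ⟨m, by omega⟩
          simp only [ht, h1, h2] at this
          simp [ht]
          revert this
          cases g ⟨m, by omega⟩ t <;> cases g ⟨m + 1, hm⟩ t <;> simp
        · have h3 : ¬ (g (finLo k ⟨m, by omega⟩) t ≠ g (finHi k ⟨m, by omega⟩) t) := by
            intro hh
            exact ht (hD' ⟨m, by omega⟩ t hh).symm
          rw [h1, h2] at h3
          simp [ht]
          exact (not_not.mp h3).symm
    intro m t
    exact this m m.isLt t
  refine ⟨L, g ⟨0, hp⟩, ⟨hlen, ?_⟩, hR⟩
  rintro u ⟨x, y, hxy⟩ hu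
  by_contra hno
  push Not at hno
  have hl : x.length + u.length + y.length = 2 ^ k - 1 := by
    rw [← hlen, ← hxy]; simp; omega
  have hu' : 0 < u.length := List.length_pos_iff.mpr hu
  have h1 : g ⟨x.length, by omega⟩ = g ⟨x.length + u.length, by omega⟩ := by
    funext t
    rw [hR ⟨x.length, by omega⟩ t, hR ⟨x.length + u.length, by omega⟩ t]
    congr 1
    unfold gr
    have e1 : L.take x.length = x := by rw [← hxy]; simp
    have e2 : L.take (x.length + u.length) = x ++ u := by
      rw [← hxy, ← List.length_append]; exact List.take_left
    change decide (Odd ((L.take x.length).count t)) =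
      decide (Odd ((L.take (x.length + u.length)).count t))
    rw [e1, e2, List.count_append, decide_eq_decide, Nat.odd_add]
    have := hno t
    rw [Nat.not_odd_iff_even] at this
    tauto
  have h2 : x.length = x.length + u.length := congrArg Fin.val (h.1.1 h1)
  omega

theorem num_eq_cnt (hj : 0 < j) (c : Fin k → ℕ) :
    numEquivClasses j k c = cnt (j := j) (k := k) (PP (vals c)) := by
  have hp : 0 < 2 ^ k := by positivity
  have hex : ∀ G : {G // IsEquipartingMatrix j k c G}, ∃ (x : Fin j → List (Fin k))
      (β : Fin j → Fin k → Bool), (∀ i, VL (x i)) ∧ ∀ i, GRel (G.1 i) (x i) (β i) := by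
    intro G
    choose x β h using fun i => gray_GRel (G.2.1 i)
    exact ⟨x, β, fun i => (h i).1, fun i => (h i).2⟩
  choose δ β hV hR using hex
  have hcts : ∀ G, cts (δ G) = c := by
    intro G
    funext t
    rw [← G.2.2.2 t]
    unfold cts
    apply Finset.sum_congr rfl
    intro i _
    rw [(hR G i).count (hV G i).1]
  have hfwd : ∀ G G' : {G // IsEquipartingMatrix j k c G}, EMEquiv j k c G.1 G'.1 →
      cls (δ G) = cls (δ G') := by
    rintro G G' ⟨b, τ, hτ, h⟩
    rw [cls_eq]
    refine ⟨τ.symm, ?_⟩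
    funext i
    have h1 : GRel (G'.1 i) ((δ G i).map τ.symm) (fun t => xor (b t) (β G i (τ t))) := by
      intro m t
      rw [h, hR G i m (τ t), gr_map]
      simp [Bool.xor_assoc]
    exact (hR G' i).unique h1 (hV G' i).1 ((hV G i).map τ.symm).1
  have hbwd : ∀ G G' : {G // IsEquipartingMatrix j k c G}, cls (δ G) = cls (δ G') →
      EMEquiv j k c G.1 G'.1 := by
    intro G G' h
    obtain ⟨σ, hσ⟩ := cls_eq.mp h
    have hG : ∀ i m t, G'.1 i m t =
        xor (xor (β G' i t) (β G i (σ.symm t))) (G.1 i m (σ.symm t)) := by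
      intro i m t
      rw [hR G' i m t, hR G i m (σ.symm t), hσ]
      simp only [actS]
      rw [gr_map]
      cases β G' i t <;> cases β G i (σ.symm t) <;> simp
    refine ⟨fun t => xor (β G' ⟨0, hj⟩ t) (β G ⟨0, hj⟩ (σ.symm t)), σ.symm, ?_, ?_⟩
    · intro t
      have h1 := cts_act σ (δ G) (σ.symm t)
      rw [← hσ, hcts, hcts, Equiv.apply_symm_apply] at h1
      exact h1.symm
    · have hconst : ∀ (i : ℕ) (hi : i < j) (t : Fin k),
          xor (β G' ⟨i, hi⟩ t) (β G ⟨i, hi⟩ (σ.symm t)) =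
          xor (β G' ⟨0, hj⟩ t) (β G ⟨0, hj⟩ (σ.symm t)) := by
        intro i
        induction i with
        | zero => intro hi t; rfl
        | succ i ih =>
          intro hi t
          rw [← ih (by omega) t]
          have l1 := congrFun (G.2.2.1 ⟨i, by omega⟩ hi) (σ.symm t)
          have l2 := congrFun (G'.2.2.1 ⟨i, by omega⟩ hi) t
          rw [hG, hG, l1] at l2
          exact (Bool.xor_left_inj.mp l2).symm
      intro i m t
      rw [hG, hconst i.val i.isLt t]
  have hsurj : ∀ x : Fin j → List (Fin k), PP (vals c) x → ∃ G, cls (δ G) = cls x := by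
    rintro x ⟨h1, h2⟩
    obtain ⟨σ, hσ⟩ := perm_of_map_eq _ _ h2
    let y := actS σ x
    have hy : ∀ t, cts y t = c t := by
      intro t
      have := cts_act σ x (σ.symm t)
      rw [Equiv.apply_symm_apply] at this
      change cts y t = _ at this
      rw [this, ← hσ, Equiv.apply_symm_apply]
    have hyV : ∀ i, VL (y i) := fun i => (h1 i).map σ
    let Y : ℕ → List (Fin k) := fun n => if h : n < j then y ⟨n, h⟩ else []
    let b : ℕ → Fin k → Bool := fun n t => decide (Odd (∑ i ∈ Finset.range n, (Y i).count t))
    let G : Fin j → Fin (2 ^ k) → Fin k → Bool := fun i m t => xor (b i t) (gr (y i) m t)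
    have hGR : ∀ i, GRel (G i) (y i) (b i) := fun i m t => rfl
    have hEM : IsEquipartingMatrix j k c G := by
      refine ⟨fun i => (hGR i).gray (hyV i), ?_, ?_⟩
      · intro i hi
        funext t
        change xor (b i t) (gr (y i) (2 ^ k - 1) t) = xor (b (i + 1) t) (gr (y _) 0 t)
        rw [gr_zero, Bool.xor_false]
        simp only [b, gr]
        rw [Finset.sum_range_succ]
        have e1 : Y i = y i := by simp [Y]
        have e2 : (y i).take (2 ^ k - 1) = y i := by
          rw [← (hyV i).1]; exact List.take_length
        rw [e1, e2]
        generalize ∑ i ∈ Finset.range i.val, (Y i).count t = A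
        generalize (y i).count t = B
        by_cases hA : Odd A <;> by_cases hB : Odd B <;>
          simp [Nat.odd_add, hA, hB, ← Nat.not_odd_iff_even]
      · intro t
        rw [← hy t]
        unfold cts
        apply Finset.sum_congr rfl
        intro i _
        exact (hGR i).count (hyV i).1 t
    refine ⟨⟨G, hEM⟩, ?_⟩
    have : δ ⟨G, hEM⟩ = y := by
      funext i
      exact (hR ⟨G, hEM⟩ i).unique (hGR i) (hV _ i).1 (hyV i).1
    rw [this]
    symm
    rw [cls_eq]
    exact ⟨σ, rfl⟩
  unfold numEquivClasses cnt
  apply Nat.card_eq_of_bijective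
    (fun q => (Quot.lift (fun G => (⟨cls (δ G), δ G, ⟨hV G, by rw [hcts]⟩, rfl⟩ :
      (cls '' {x : Fin j → List (Fin k) | PP (vals c) x})))
      (fun G G' h => Subtype.ext (hfwd G G' h)) q))
  constructor
  · intro q q' h
    induction q using Quot.ind with
    | _ G =>
    induction q' using Quot.ind with
    | _ G' =>
    apply Quot.sound
    exact hbwd G G' (congrArg Subtype.val h)
  · rintro ⟨_, x, hx, rfl⟩
    obtain ⟨G, hG⟩ := hsurj x hx
    exact ⟨Quot.mk _ G, Subtype.ext hG⟩

theorem num_odd (hj : 2 ≤ j) (i0 : Fin j) (c : Fin k → ℕ) :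
    Odd (numEquivClasses j k c) ↔ Odd (Zc k (fun _ : Fin j => 1) i0 (vals c)) := by
  rw [num_eq_cnt (by omega), odd_congr (cnt_std hj _), cnt_Z i0]

theorem sum_tot (π : Fin j → Equiv.Perm (Fin k)) :
    ∑ t, tot (fun _ => 1) π t = j * (2 ^ k - 1) := by
  unfold tot
  rw [Finset.sum_comm]
  have : ∀ i : Fin j, ∑ t : Fin k, 1 * 2 ^ ((π i t : Fin k) : ℕ) = 2 ^ k - 1 := by
    intro i
    simp only [one_mul]
    rw [Equiv.sum_comp (π i) (fun t : Fin k => 2 ^ (t : ℕ)), Fin.sum_univ_eq_sum_range (fun t => 2 ^ t),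
      Nat.geomSum_eq (le_refl 2)]
    simp
  rw [Finset.sum_congr rfl (fun i _ => this i)]
  simp

end Matrices

theorem E_value (k n r : ℕ) (hk : 2 ≤ k) (hr1 : 1 ≤ r) (hr2 : r ≤ 2 ^ n) :
    IsLeast {M : ℕ | ∃ c : Fin k → ℕ,
        (∑ t, c t) = (2 ^ n + r) * (2 ^ k - 1) ∧
        Odd (numEquivClasses (2 ^ n + r) k c) ∧
        M = Finset.univ.sup c}
      (2 ^ (n + k - 1) + r) := by
  have hp : 0 < 2 ^ n := by positivity
  have hj : 2 ≤ 2 ^ n + r := by omega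
  have hlow : ∀ c : Fin k → ℕ, Odd (numEquivClasses (2 ^ n + r) k c) →
      2 ^ (n + k - 1) + r ≤ Finset.univ.sup c := by
    intro c h
    rw [num_odd hj ⟨0, by omega⟩] at h
    obtain ⟨y, hy, hle⟩ := Zc_lower (by omega) hr1 rfl _ _ h
    rw [mem_vals] at hy
    obtain ⟨t, rfl⟩ := hy
    exact hle.trans (Finset.le_sup (Finset.mem_univ t))
  constructor
  · obtain ⟨C, hC, hodd⟩ := Zc_upper k n r _ hr1 hr2 rfl ⟨0, by omega⟩
    obtain ⟨π, _, h2⟩ := Zc_pos _ _ _ hodd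
    have hodd' : Odd (numEquivClasses (2 ^ n + r) k (tot (fun _ => 1) π)) := by
      rw [num_odd hj ⟨0, by omega⟩, h2]; exact hodd
    refine ⟨tot (fun _ => 1) π, sum_tot π, hodd', le_antisymm (hlow _ hodd') ?_⟩
    apply Finset.sup_le
    intro t _
    have := hC (tot (fun _ => 1) π t) (by rw [← h2, mem_vals]; exact ⟨t, rfl⟩)
    have h5 : 2 ^ (n + k) = 2 * 2 ^ (n + k - 1) := by
      rw [← pow_succ']; congr 1; omega
    omega
  · rintro M ⟨c, _, h, rfl⟩
    exact hlow c h
end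

section
/- Let j ≥ 1, k ≥ 2 and let c_1,…,c_k be nonnegative integers with c_1+…+c_k = j(2^k−1). If the number of isomorphism classes of (c_1,…,c_k)-equiparting matrices is odd, then c_1,…,c_k are pairwise distinct. -/
theorem isGrayCode_perm (k : ℕ) (e : Equiv.Perm (Fin k)) (g : Fin (2 ^ k) → Fin k → Bool)
    (h : IsGrayCode k g) : IsGrayCode k (fun m t => g m (e t)) := by
  refine ⟨?_, ?_⟩
  · exact (Equiv.arrowCongr e.symm (Equiv.refl Bool)).bijective.comp h.1
  · intro i
    obtain ⟨t, ht, hu⟩ := h.2 i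
    refine ⟨e.symm t, by simpa using ht, ?_⟩
    intro y hy
    rw [Equiv.eq_symm_apply]
    exact hu _ hy

theorem isEquiparting_perm (j k : ℕ) (c : Fin k → ℕ) (e : Equiv.Perm (Fin k))
    (he : ∀ t, c (e t) = c t) (G : Fin j → Fin (2 ^ k) → Fin k → Bool)
    (h : IsEquipartingMatrix j k c G) :
    IsEquipartingMatrix j k c (fun i m t => G i m (e t)) := by
  refine ⟨fun i => isGrayCode_perm k e _ (h.1 i), ?_, ?_⟩
  · intro i hi
    funext t
    exact congrFun (h.2.1 i hi) (e t)
  · intro t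
    rw [← he t, ← h.2.2 (e t)]
    rfl

/-- If the number of isomorphism classes of `c`-equiparting matrices is odd, then the
entries of `c` are pairwise distinct. -/
theorem odd_numIsoClasses_pairwise_distinct (j k : ℕ) (hj : 1 ≤ j) (hk : 2 ≤ k)
    (c : Fin k → ℕ) (hsum : (∑ t, c t) = j * (2 ^ k - 1))
    (hodd : Odd (numIsoClasses j k c)) :
    Function.Injective c := by
  intro a b hab
  by_contra hne
  have he : ∀ t, c (Equiv.swap a b t) = c t := by
    intro t
    by_cases h1 : t = a
    · subst h1; simp [hab]
    · by_cases h2 : t = b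
      · subst h2; simp [hab]
      · rw [Equiv.swap_apply_of_ne_of_ne h1 h2]
  let r := fun G G' : {G // IsEquipartingMatrix j k c G} => EMIso j k G.1 G'.1
  let S : {G // IsEquipartingMatrix j k c G} → {G // IsEquipartingMatrix j k c G} :=
    fun G => ⟨fun i m t => G.1 i m (Equiv.swap a b t), isEquiparting_perm j k c _ he G.1 G.2⟩
  have hSS : ∀ G, S (S G) = G := by
    intro G
    apply Subtype.ext
    funext i m t
    simp [S]
  have hS : ∀ G G', r G G' → r (S G) (S G') := by
    rintro G G' ⟨β, hβ⟩
    exact ⟨fun t => β (Equiv.swap a b t), fun i m t => hβ i m _⟩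
  let F : Quot r → Quot r := Quot.map S hS
  have hFF : ∀ q, F (F q) = q := by
    rintro ⟨G⟩
    exact congrArg (Quot.mk r) (hSS G)
  let z : Fin (2 ^ k) := ⟨0, pow_pos (by norm_num) k⟩
  let i0 : Fin j := ⟨0, hj⟩
  let inv : Quot r → Fin (2 ^ k) → Fin k → Bool :=
    Quot.lift (fun G m t => xor (G.1 i0 m t) (G.1 i0 z t)) (by
      rintro G G' ⟨β, hβ⟩
      funext m t
      simp only [hβ]
      cases β t <;> simp)
  have hF : ∀ q, F q ≠ q := by
    rintro ⟨G⟩ hq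
    have h1 : ∀ m, xor (G.1 i0 m (Equiv.swap a b a)) (G.1 i0 z (Equiv.swap a b a))
        = xor (G.1 i0 m a) (G.1 i0 z a) := fun m =>
      congrFun (congrFun (congrArg inv hq) m) a
    obtain ⟨m, hm⟩ := (G.2.1 i0).1.2 (Function.update (G.1 i0 z) a (!(G.1 i0 z a)))
    have h2 := h1 m
    rw [hm, Equiv.swap_apply_left, Function.update_self,
      Function.update_of_ne (Ne.symm hne)] at h2
    simp at h2
  have : Fintype (Quot r) := Fintype.ofFinite _
  have hz : (∑ _q : Quot r, (1 : ZMod 2)) = 0 :=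
    Finset.sum_involution (fun q _ => F q) (fun _ _ => by decide)
      (fun q _ _ => hF q) (fun _ _ => Finset.mem_univ _) (fun q _ => hFF q)
  have hc : numIsoClasses j k c = Fintype.card (Quot r) := Nat.card_eq_fintype_card
  rw [hc] at hodd
  rw [Finset.sum_const, Finset.card_univ, nsmul_eq_mul, mul_one,
    ZMod.natCast_eq_zero_iff_even] at hz
  exact (Nat.not_even_iff_odd.mpr hodd) hz
end

section
/- Let n ≥ 0 and 0 ≤ r ≤ 2^n be integers with j = 2^n + r ≥ 2, and let k = 2. Then the number of equivalence classes of (2^n + 2r, 2^{n+1} + r)-equiparting matrices is odd. -/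
theorem odd_choose_aux (n r : ℕ) (hr : r < 2 ^ n) : Odd ((2 ^ n + r).choose r) := by
  rw [Nat.add_choose_eq, Finset.Nat.sum_antidiagonal_eq_sum_range_succ_mk,
    Finset.sum_range_succ', Nat.odd_iff]
  have h : 2 ∣ ∑ k ∈ Finset.range r,
      (2 ^ n).choose (k + 1) * r.choose (r - (k + 1)) := by
    apply Finset.dvd_sum
    intro k hk
    have hk := Finset.mem_range.1 hk
    apply Dvd.dvd.mul_right
    exact (Nat.Prime.dvd_choose_pow_iff Nat.prime_two).2 ⟨by omega, by omega⟩
  simp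
  omega

/-- The 2-bit code with start `s` and first changed coordinate `a`. -/
def gcode (s : Fin 2 → Bool) (a : Fin 2) : Fin (2 ^ 2) → Fin 2 → Bool :=
  fun m t => xor (s t) (if t = a then (m == 1 || m == 2) else (m == 2 || m == 3))

/-- The first changed coordinate. -/
def gword (g : Fin (2 ^ 2) → Fin 2 → Bool) : Fin 2 := if g 0 0 ≠ g 1 0 then 0 else 1

theorem gword_gcode : ∀ s a, gword (gcode s a) = a := by decide

theorem isGray_gcode (s : Fin 2 → Bool) (a : Fin 2) : IsGrayCode 2 (gcode s a) := by
  constructor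
  · rw [Fintype.bijective_iff_injective_and_card]
    refine ⟨?_, by simp⟩
    revert s a
    decide
  · unfold ExistsUnique
    revert s a
    decide

theorem count_gcode : ∀ s a t, grayTransCount 2 (gcode s a) t = if t = a then 2 else 1 := by
  decide

theorem gcode_act : ∀ (β s : Fin 2 → Bool) (τ : Equiv.Perm (Fin 2)) a m t,
    gcode (fun t => xor (β t) (s (τ t))) (τ a) m t = xor (β t) (gcode s a m (τ t)) := by
  decide

theorem exu : ∀ a b : Fin 2 → Bool, (∃! t, a t ≠ b t) →
    xor (a 0 != b 0) (a 1 != b 1) = true := by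
  unfold ExistsUnique
  decide

theorem gray_eq (g : Fin (2 ^ 2) → Fin 2 → Bool) (h : IsGrayCode 2 g) :
    g = gcode (g 0) (gword g) := by
  obtain ⟨⟨hi, -⟩, h2⟩ := h
  have n02 : g 0 ≠ g 2 := fun h => absurd (hi h) (by decide)
  have n13 : g 1 ≠ g 3 := fun h => absurd (hi h) (by decide)
  have n03 : g 0 ≠ g 3 := fun h => absurd (hi h) (by decide)
  have e0 : ∃! t, g 0 t ≠ g 1 t := h2 ⟨0, by norm_num⟩
  have e1 : ∃! t, g 1 t ≠ g 2 t := h2 ⟨1, by norm_num⟩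
  have e2 : ∃! t, g 2 t ≠ g 3 t := h2 ⟨2, by norm_num⟩
  have key : ∀ a b c d : Fin 2 → Bool, a ≠ c → b ≠ d → a ≠ d → (xor (a 0 != b 0) (a 1 != b 1) = true) →
      (xor (b 0 != c 0) (b 1 != c 1) = true) → (xor (c 0 != d 0) (c 1 != d 1) = true) →
      ∀ t, b t = gcode a (if a 0 ≠ b 0 then 0 else 1) 1 t ∧
        c t = gcode a (if a 0 ≠ b 0 then 0 else 1) 2 t ∧
        d t = gcode a (if a 0 ≠ b 0 then 0 else 1) 3 t := by
    set_option synthInstance.maxHeartbeats 1000000 in set_option synthInstance.maxSize 4096 in set_option maxRecDepth 100000 in decide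
  have k := key _ _ _ _ n02 n13 n03 (exu _ _ e0) (exu _ _ e1) (exu _ _ e2)
  funext m t
  obtain ⟨k1, k2, k3⟩ := k t
  fin_cases m
  · simp [gcode]
  · exact k1
  · exact k2
  · exact k3

theorem gcode_last : ∀ s a t, gcode s a 3 t = xor (s t) (decide (t ≠ a)) := by decide

theorem gword_act (g g' : Fin (2 ^ 2) → Fin 2 → Bool) (h : IsGrayCode 2 g)
    (β : Fin 2 → Bool) (τ : Equiv.Perm (Fin 2))
    (hh : ∀ m t, g' m t = xor (β t) (g m (τ t))) : gword g' = τ (gword g) := by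
  have : g' = gcode (fun t => xor (β t) (g 0 (τ t))) (τ (gword g)) := by
    funext m t
    rw [gcode_act, ← gray_eq g h, hh]
  rw [this, gword_gcode]

theorem act_of_word {j : ℕ} {c : Fin 2 → ℕ} (hj : 0 < j)
    (G G' : Fin j → Fin (2 ^ 2) → Fin 2 → Bool)
    (hG : IsEquipartingMatrix j 2 c G) (hG' : IsEquipartingMatrix j 2 c G')
    (τ : Equiv.Perm (Fin 2)) (hw : ∀ i, gword (G' i) = τ (gword (G i))) :
    ∃ β : Fin 2 → Bool, ∀ i m t, G' i m t = xor (β t) (G i m (τ t)) := by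
  set β : Fin 2 → Bool := fun t => xor (G' ⟨0, hj⟩ 0 t) (G ⟨0, hj⟩ 0 (τ t)) with hβ
  refine ⟨β, ?_⟩
  have step : ∀ i, (∀ t, G' i 0 t = xor (β t) (G i 0 (τ t))) →
      ∀ m t, G' i m t = xor (β t) (G i m (τ t)) := by
    intro i h m t
    have h' : G' i 0 = fun t => xor (β t) (G i 0 (τ t)) := funext h
    rw [gray_eq _ (hG'.1 i), hw, h', gcode_act, ← gray_eq _ (hG.1 i)]
  have : ∀ (i : ℕ) (hi : i < j) m t, G' ⟨i, hi⟩ m t = xor (β t) (G ⟨i, hi⟩ m (τ t)) := by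
    intro i
    induction i with
    | zero => intro hi; apply step; intro t; simp [hβ]
    | succ i ih =>
      intro hi
      apply step
      intro t
      have a := hG.2.1 ⟨i, by omega⟩ hi
      have b := hG'.2.1 ⟨i, by omega⟩ hi
      have := ih (by omega) 3 t
      calc _ = G' ⟨i, by omega⟩ 3 t := (congrFun b t).symm
        _ = _ := this
        _ = _ := by
          congr 1
          exact congrFun a (τ t)
  exact fun i => this i.1 i.2

/-- start vectors -/
def gstart (w : ℕ → Fin 2) : ℕ → Fin 2 → Bool
  | 0 => fun _ => false
  | i + 1 => gcode (gstart w i) (w i) 3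

theorem sum_word {j : ℕ} (w : Fin j → Fin 2) (t : Fin 2) :
    (∑ i, if t = w i then 2 else 1) = j + (Finset.univ.filter fun i => w i = t).card := by
  rw [Finset.card_filter]
  have : ∀ i, (if t = w i then 2 else 1) = 1 + if w i = t then 1 else 0 := by
    intro i
    by_cases h : w i = t
    · simp [h]
    · simp [h, Ne.symm h]
  simp only [this, Finset.sum_add_distrib]
  simp

theorem card_word {j : ℕ} (w : Fin j → Fin 2) :
    (Finset.univ.filter fun i => w i = 0).card + (Finset.univ.filter fun i => w i = 1).card = j := by
  have := Finset.card_filter_add_card_filter_not (s := (Finset.univ : Finset (Fin j)))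
    (fun i => w i = 0)
  simp only [Finset.card_univ, Fintype.card_fin] at this
  have e : ∀ x : Fin 2, ¬ x = 0 ↔ x = 1 := by decide
  simpa only [e] using this

theorem word_count {j : ℕ} {c : Fin 2 → ℕ} (G : Fin j → Fin (2 ^ 2) → Fin 2 → Bool)
    (hG : IsEquipartingMatrix j 2 c G) (t : Fin 2) :
    j + (Finset.univ.filter fun i => gword (G i) = t).card = c t := by
  rw [← hG.2.2 t, ← sum_word]
  apply Finset.sum_congr rfl
  intro i _
  conv_rhs => rw [gray_eq _ (hG.1 i), count_gcode]

theorem exists_word {j : ℕ} {c : Fin 2 → ℕ} (w : Fin j → Fin 2)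
    (hw : ∀ t, j + (Finset.univ.filter fun i => w i = t).card = c t) :
    ∃ G, IsEquipartingMatrix j 2 c G ∧ ∀ i, gword (G i) = w i := by
  set w' : ℕ → Fin 2 := fun i => if h : i < j then w ⟨i, h⟩ else 0 with hw'
  have e : ∀ i : Fin j, w' i = w i := by intro i; simp [hw']
  refine ⟨fun i => gcode (gstart w' i) (w' i), ⟨fun i => isGray_gcode _ _, ?_, ?_⟩, ?_⟩
  · intro i h
    funext t
    have : ∀ s a t, gcode s a 0 t = s t := by decide
    exact (this (gstart w' (i + 1)) (w' (i + 1)) t).symm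
  · intro t
    simp only [count_gcode, e]
    rw [sum_word, hw]
  · intro i
    rw [gword_gcode, e]

theorem case_lt (n r : ℕ) (hr : r < 2 ^ n) :
    Odd (numEquivClasses (2 ^ n + r) 2 ![2 ^ n + 2 * r, 2 ^ (n + 1) + r]) := by
  have hp : 2 ^ (n + 1) = 2 * 2 ^ n := by ring
  have hj : 0 < 2 ^ n + r := by omega
  have hw : ∀ w : Fin (2 ^ n + r) → Fin 2, (Finset.univ.filter fun i => w i = 0).card = r ↔
    ∀ t, (2 ^ n + r) + (Finset.univ.filter fun i => w i = t).card =
      (![2 ^ n + 2 * r, 2 ^ (n + 1) + r] : Fin 2 → ℕ) t := by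
    intro w
    have := card_word w
    simp only [Fin.forall_fin_two, Matrix.cons_val_zero, Matrix.cons_val_one]
    omega
  have hτ : ∀ τ : Equiv.Perm (Fin 2), (∀ t, (![2 ^ n + 2 * r, 2 ^ (n + 1) + r] : Fin 2 → ℕ) (τ t) =
      (![2 ^ n + 2 * r, 2 ^ (n + 1) + r] : Fin 2 → ℕ) t) → τ = 1 := by
    intro τ h
    have h0 := h 0
    have : τ 0 = 0 ∨ τ 0 = 1 := by generalize τ 0 = x; revert x; decide
    have e : ∀ τ : Equiv.Perm (Fin 2), τ 0 = 0 → τ = 1 := by decide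
    rcases this with h1 | h1
    · exact e τ h1
    · rw [h1] at h0
      simp only [Matrix.cons_val_zero, Matrix.cons_val_one] at h0
      omega
  have : numEquivClasses (2 ^ n + r) 2 ![2 ^ n + 2 * r, 2 ^ (n + 1) + r] =
      Nat.card (Finset.powersetCard r (Finset.univ : Finset (Fin (2 ^ n + r)))) := by
    refine Nat.card_eq_of_bijective (Quot.lift (fun G =>
      ⟨Finset.univ.filter fun i => gword (G.1 i) = 0, ?_⟩) ?_) ⟨?_, ?_⟩
    · rw [Finset.mem_powersetCard]
      exact ⟨Finset.subset_univ _, (hw _).2 (word_count G.1 G.2)⟩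
    · rintro ⟨G, hG⟩ ⟨G', hG'⟩ ⟨β, τ, h1, h2⟩
      have : ∀ i, gword (G' i) = gword (G i) := by
        intro i
        rw [gword_act (G i) (G' i) (hG.1 i) β τ (h2 i), hτ τ h1]
        rfl
      simp [this]
    · rintro ⟨G, hG⟩ ⟨G', hG'⟩ h
      apply Quot.sound
      have h := congrArg Subtype.val h
      have h : ∀ i, gword (G i) = 0 ↔ gword (G' i) = 0 := by
        intro i
        simpa using congrArg (i ∈ ·) h
      have e : ∀ a b : Fin 2, (a = 0 ↔ b = 0) → b = (1 : Equiv.Perm (Fin 2)) a := by decide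
      obtain ⟨β, hβ⟩ := act_of_word hj G G' hG hG' 1 (fun i => e _ _ (h i))
      exact ⟨β, 1, fun t => rfl, hβ⟩
    · rintro ⟨S, hS⟩
      rw [Finset.mem_powersetCard] at hS
      have hS' : (Finset.univ.filter fun i => (if i ∈ S then 0 else 1 : Fin 2) = 0) = S := by
        ext i; simp
      obtain ⟨G, hG, h⟩ := exists_word (fun i => (if i ∈ S then 0 else 1 : Fin 2))
        ((hw _).1 (by rw [hS']; exact hS.2))
      refine ⟨Quot.mk _ ⟨G, hG⟩, ?_⟩
      apply Subtype.ext
      simp only [h]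
      exact hS'
  rw [this]
  simpa using odd_choose_aux n r hr

theorem case_eq (n : ℕ) :
    Odd (numEquivClasses (2 ^ n + 2 ^ n) 2 ![2 ^ n + 2 * 2 ^ n, 2 ^ (n + 1) + 2 ^ n]) := by
  have hp : 2 ^ (n + 1) = 2 * 2 ^ n := by ring
  have hpos : 0 < 2 ^ n := by positivity
  have hj : 0 < 2 ^ n + 2 ^ n := by omega
  have hw : ∀ (t : Fin 2) (w : Fin (2 ^ n + 2 ^ n) → Fin 2),
    (Finset.univ.filter fun i => w i = t).card = 2 ^ n ↔
    ∀ t, (2 ^ n + 2 ^ n) + (Finset.univ.filter fun i => w i = t).card =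
      (![2 ^ n + 2 * 2 ^ n, 2 ^ (n + 1) + 2 ^ n] : Fin 2 → ℕ) t := by
    intro t w
    have := card_word w
    have ht : t = 0 ∨ t = 1 := by revert t; decide
    simp only [Fin.forall_fin_two, Matrix.cons_val_zero, Matrix.cons_val_one]
    rcases ht with rfl | rfl <;> omega
  have hc : ∀ t, (![2 ^ n + 2 * 2 ^ n, 2 ^ (n + 1) + 2 ^ n] : Fin 2 → ℕ) t = 3 * 2 ^ n := by
    simp only [Fin.forall_fin_two, Matrix.cons_val_zero, Matrix.cons_val_one]
    omega
  set o : Fin (2 ^ n + 2 ^ n) := ⟨0, hj⟩ with ho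
  have : numEquivClasses (2 ^ n + 2 ^ n) 2 ![2 ^ n + 2 * 2 ^ n, 2 ^ (n + 1) + 2 ^ n] =
      Nat.card (Finset.powersetCard (2 ^ n - 1)
        ((Finset.univ : Finset (Fin (2 ^ n + 2 ^ n))).erase o)) := by
    refine Nat.card_eq_of_bijective (Quot.lift (fun G =>
      ⟨(Finset.univ.filter fun i => gword (G.1 i) = gword (G.1 o)).erase o, ?_⟩) ?_) ⟨?_, ?_⟩
    · rw [Finset.mem_powersetCard]
      refine ⟨Finset.erase_subset_erase _ (Finset.subset_univ _), ?_⟩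
      rw [Finset.card_erase_of_mem (by simp), (hw _ _).2 (word_count G.1 G.2)]
    · rintro ⟨G, hG⟩ ⟨G', hG'⟩ ⟨β, τ, h1, h2⟩
      have : ∀ i, gword (G' i) = τ (gword (G i)) := by
        intro i
        rw [gword_act (G i) (G' i) (hG.1 i) β τ (h2 i)]
      simp [this]
    · rintro ⟨G, hG⟩ ⟨G', hG'⟩ h
      apply Quot.sound
      have h := congrArg Subtype.val h
      have h : ∀ i, gword (G i) = gword (G o) ↔ gword (G' i) = gword (G' o) := by
        intro i
        by_cases hi : i = o
        · simp [hi]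
        · simpa [hi] using congrArg (i ∈ ·) h
      have e : ∀ a b : Fin 2, ∃ τ : Equiv.Perm (Fin 2), ∀ x y, (x = a ↔ y = b) → y = τ x := by
        decide
      obtain ⟨τ, hτ⟩ := e (gword (G o)) (gword (G' o))
      obtain ⟨β, hβ⟩ := act_of_word hj G G' hG hG' τ (fun i => hτ _ _ (h i))
      exact ⟨β, τ, fun t => by rw [hc, hc], hβ⟩
    · rintro ⟨S, hS⟩
      rw [Finset.mem_powersetCard] at hS
      have hoS : o ∉ S := fun h => by simpa using hS.1 h
      have hS' : (Finset.univ.filter fun i =>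
          (if i ∈ insert o S then 0 else 1 : Fin 2) = 0) = insert o S := by
        ext i; simp [or_iff_not_imp_left]
      obtain ⟨G, hG, h⟩ := exists_word (fun i => (if i ∈ insert o S then 0 else 1 : Fin 2))
        ((hw 0 _).1 (by rw [hS', Finset.card_insert_of_notMem hoS, hS.2]; omega))
      refine ⟨Quot.mk _ ⟨G, hG⟩, ?_⟩
      apply Subtype.ext
      simp only [h]
      rw [if_pos (Finset.mem_insert_self o S), hS', Finset.erase_insert hoS]
  rw [this]
  have := odd_choose_aux n (2 ^ n - 1) (by omega)
  rw [← Nat.add_sub_assoc hpos] at this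
  rw [Nat.card_eq_fintype_card, Fintype.card_coe, Finset.card_powersetCard,
    Finset.card_erase_of_mem (Finset.mem_univ _), Finset.card_univ, Fintype.card_fin]
  exact this

/-- For `k = 2` and `j = 2^n + r ≥ 2` with `0 ≤ r ≤ 2^n`, the number of equivalence
classes of `(2^n + 2r, 2^(n+1) + r)`-equiparting matrices is odd. -/
theorem odd_numEquivClasses_two (n r : ℕ) (hr : r ≤ 2 ^ n) (hj : 2 ≤ 2 ^ n + r) :
    Odd (numEquivClasses (2 ^ n + r) 2 ![2 ^ n + 2 * r, 2 ^ (n + 1) + r]) := by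
  rcases hr.lt_or_eq with h | h
  · exact case_lt n r h
  · subst h
    exact case_eq n
end
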